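/- Let h(x) = x¹¹ + x⁷·(3x + 2)·t + x·(3x⁴ + (14/5)x³ + (4/5)x² − (40/81)x − 16/81)·t² − (x − 2/5)·(x + 2/5)·t³, a polynomial of degree 11 in x with coefficients in ℚ(t). Then the Galois group of (the splitting field of) h over ℚ(t) is a simple group of cardinality 7920 (i.e., it is isomorphic to the Mathieu group M₁₁). -/

import Mathlib

open Polynomial

/-- The generator `t` of the rational function field `ℚ(t)`. -/
noncomputable def t : RatFunc ℚ := RatFunc.X

/-- `h(x) = x¹¹ + x⁷(3x+2)t + x(3x⁴ + (14/5)x³ + (4/5)x² − (40/81)x − 16/81)t²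
  − (x − 2/5)(x + 2/5)t³` over `ℚ(t)`. -/
noncomputable def h : Polynomial (RatFunc ℚ) :=
  X ^ 11 + X ^ 7 * (3 * X + 2) * C t +
    X * (3 * X ^ 4 + C (14 / 5 : RatFunc ℚ) * X ^ 3 + C (4 / 5 : RatFunc ℚ) * X ^ 2 -
      C (40 / 81 : RatFunc ℚ) * X - C (16 / 81 : RatFunc ℚ)) * C t ^ 2 -
    (X - C (2 / 5 : RatFunc ℚ)) * (X + C (2 / 5 : RatFunc ℚ)) * C t ^ 3

namespace M11
section Grp
variable {G α : Type*} [Group G] [Finite G] [MulAction G α] [FaithfulSMul G α]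

lemma trans_of_card (hα : Nat.card α = 11) (P : Subgroup G) (hP : Nat.card P = 11) :
    MulAction.IsPretransitive P α := by
  have hfin : Finite α := Nat.finite_of_card_ne_zero (by omega)
  obtain ⟨g, hg⟩ : ∃ g : P, g ≠ 1 := by
    have : Nontrivial P := Finite.one_lt_card_iff_nontrivial.1 (by omega)
    exact exists_ne 1
  obtain ⟨x, hx⟩ : ∃ x : α, g • x ≠ x := by
    by_contra! hcon
    exact hg (FaithfulSMul.eq_of_smul_eq_smul (α := α) (fun a => by rw [hcon, one_smul]))
  have h1 : Nat.card (MulAction.orbit P x) ∣ 11 := by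
    rw [← hP, ← Nat.card_congr (MulAction.orbitProdStabilizerEquivGroup P x), Nat.card_prod]
    exact dvd_mul_right _ _
  have h2 : Nat.card (MulAction.orbit P x) ≠ 1 := by
    intro h
    obtain ⟨hs, _⟩ := Nat.card_eq_one_iff_unique.1 h
    have := hs.elim ⟨g • x, MulAction.mem_orbit _ _⟩ ⟨x, MulAction.mem_orbit_self x⟩
    exact hx (congrArg Subtype.val this)
  have h3 : Nat.card (MulAction.orbit P x) = 11 :=
    ((Nat.dvd_prime (by norm_num)).1 h1).resolve_left h2
  have h4 : MulAction.orbit P x = Set.univ := by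
    apply Set.eq_of_subset_of_ncard_le (Set.subset_univ _)
    rw [Set.ncard_univ, hα, ← h3]; rfl
  rw [MulAction.isPretransitive_iff_base x]
  intro y
  have : y ∈ MulAction.orbit P x := by rw [h4]; trivial
  exact this

lemma centralizer_le (hα : Nat.card α = 11) (P : Subgroup G) (hP : Nat.card P = 11) :
    Subgroup.centralizer (P : Set G) ≤ P := by
  have htr := trans_of_card hα P hP
  have hcyc : IsCyclic P := by
    have : Fact (Nat.Prime 11) := ⟨by norm_num⟩
    exact isCyclic_of_prime_card hP
  have hcomm : ∀ a b : P, a * b = b * a := fun a b => by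
    let := hcyc.commGroup
    exact mul_comm a b
  have hne : Nonempty α := (Nat.card_pos_iff.1 (by omega)).1
  obtain ⟨x⟩ := hne
  intro c hc
  obtain ⟨g, hg⟩ := htr.exists_smul_eq x (c • x)
  have : c = (g : G) := by
    apply FaithfulSMul.eq_of_smul_eq_smul (α := α)
    intro y
    obtain ⟨k, rfl⟩ := htr.exists_smul_eq x y
    have h1 := hc (k : G) k.2
    change c • ((k : G) • x) = (g : G) • ((k : G) • x)
    rw [← mul_smul, ← h1, mul_smul, ← hg]
    change (k : G) • ((g : G) • x) = _
    rw [← mul_smul, ← mul_smul]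
    have := congrArg (Subtype.val) (hcomm k g)
    simp only [Subgroup.coe_mul] at this
    rw [this]
  rw [this]; exact g.2

lemma card_normalizer (hα : Nat.card α = 11) (P : Subgroup G) (hP : Nat.card P = 11) :
    ∃ d, d ∣ 10 ∧ Nat.card (Subgroup.normalizer (P : Set G)) = 11 * d := by
  have hcyc : IsCyclic P := by
    have : Fact (Nat.Prime 11) := ⟨by norm_num⟩
    exact isCyclic_of_prime_card hP
  have key := Subgroup.card_subgroup_dvd_card (P.normalizerMonoidHom.range)
  rw [IsCyclic.card_mulAut, hP, show Nat.totient 11 = 10 by decide] at key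
  refine ⟨_, key, ?_⟩
  have h1 := Subgroup.card_mul_index (P.normalizerMonoidHom.ker)
  rw [Subgroup.index_ker] at h1
  rw [← h1]
  congr 1
  rw [Subgroup.normalizerMonoidHom_ker]
  have h2 : Subgroup.centralizer (P : Set G) = P := by
    apply le_antisymm (centralizer_le hα P hP)
    intro a ha b hb
    let := hcyc.commGroup
    exact congrArg Subtype.val (mul_comm (⟨b, hb⟩ : P) ⟨a, ha⟩)
  rw [h2, ← hP]
  exact Nat.card_congr (Subgroup.subgroupOfEquivOfLe (Subgroup.le_normalizer)).toEquiv

lemma eleven_dvd_normal (hα : Nat.card α = 11) (P : Subgroup G) (hP : Nat.card P = 11)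
    (N : Subgroup G) [N.Normal] (hN : N ≠ ⊥) : 11 ∣ Nat.card N := by
  have htr := trans_of_card hα P hP
  have htG : MulAction.IsPretransitive G α := by
    rw [MulAction.isPretransitive_iff]
    intro x y
    obtain ⟨g, hg⟩ := htr.exists_smul_eq x y
    exact ⟨g, hg⟩
  have hprim : MulAction.IsPreprimitive G α :=
    MulAction.IsPreprimitive.of_prime_card (by rw [hα]; norm_num)
  have hNt : MulAction.IsPretransitive N α := by
    apply MulAction.IsQuasiPreprimitive.isPretransitive_of_normal (G := G)
    intro hfix
    apply hN
    rw [eq_bot_iff]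
    intro n hn
    rw [Subgroup.mem_bot]
    apply FaithfulSMul.eq_of_smul_eq_smul (α := α)
    intro y
    rw [one_smul]
    have : y ∈ MulAction.fixedPoints N α := by rw [hfix]; trivial
    exact this ⟨n, hn⟩
  obtain ⟨x⟩ : Nonempty α := (Nat.card_pos_iff.1 (by omega)).1
  rw [← Nat.card_congr (MulAction.orbitProdStabilizerEquivGroup N x), Nat.card_prod,
    MulAction.orbit_eq_univ, Nat.card_univ, hα]
  exact dvd_mul_right _ _

lemma exists_sylow_card (hd : 11 ∣ Nat.card G) (hnd : ¬ 121 ∣ Nat.card G) (P : Sylow 11 G) :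
    Nat.card P = 11 := by
  have : Fact (Nat.Prime 11) := ⟨by norm_num⟩
  obtain ⟨n, hn⟩ := P.2.exists_card_eq
  have h1 : Nat.card P ∣ Nat.card G := Subgroup.card_subgroup_dvd_card _
  rcases n with _ | _ | n
  · exfalso
    apply P.not_dvd_index
    have := Subgroup.card_mul_index (P : Subgroup G)
    rw [hn] at this
    rw [← this] at hd
    simpa using hd
  · simpa using hn
  · exfalso
    apply hnd
    refine dvd_trans ?_ h1
    change 121 ∣ Nat.card (P : Subgroup G)
    rw [hn]
    exact ⟨11 ^ n, by ring⟩

lemma sylow_count (hα : Nat.card α = 11) (P : Sylow 11 G) (hP : Nat.card P = 11) :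
    ∃ d n, d ∣ 10 ∧ Nat.card (Subgroup.normalizer (P : Set G)) = 11 * d ∧
      (Subgroup.normalizer (P : Set G)).index = n ∧ 11 * d * n = Nat.card G ∧ n % 11 = 1 := by
  have : Fact (Nat.Prime 11) := ⟨by norm_num⟩
  obtain ⟨d, hd, hc⟩ := card_normalizer hα (P : Subgroup G) hP
  refine ⟨d, _, hd, hc, rfl, ?_, ?_⟩
  · rw [← hc]; exact Subgroup.card_mul_index _
  · have h1 := card_sylow_modEq_one 11 G
    rw [P.card_eq_index_normalizer] at h1
    exact h1

lemma unique_sylow (K : Type*) [Group K] [Finite K] (hK : Nat.card K = 165) (P : Sylow 11 K) :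
    (P : Subgroup K).Normal := by
  have : Fact (Nat.Prime 11) := ⟨by norm_num⟩
  have h1 := card_sylow_modEq_one 11 K
  have hP : Nat.card P = 11 := exists_sylow_card (by rw [hK]; norm_num) (by rw [hK]; norm_num) P
  have h2 := P.card_dvd_index
  have h3 := Subgroup.card_mul_index (P : Subgroup K)
  have h4 : (P : Subgroup K).index = 15 := by
    have : Nat.card (P : Subgroup K) = 11 := hP
    rw [this, hK] at h3; omega
  rw [h4] at h2
  have h5 : Nat.card (Sylow 11 K) = 1 := by
    generalize Nat.card (Sylow 11 K) = n at *
    have : n ≤ 15 := Nat.le_of_dvd (by norm_num) h2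
    unfold Nat.ModEq at h1
    interval_cases n <;> simp_all
  have := (Nat.card_eq_one_iff_unique.1 h5).1
  exact Sylow.normal_of_subsingleton P

lemma not_1320 (hα : Nat.card α = 11) (hG : Nat.card G = 1320) (g : G) (hg : 8 ∣ orderOf g) :
    False := by
  have : Fact (Nat.Prime 11) := ⟨by norm_num⟩
  have : Fact (Nat.Prime 2) := ⟨by norm_num⟩
  obtain ⟨m, hm⟩ := hg
  have hm0 : m ≠ 0 := by rintro rfl; exact (orderOf_pos g).ne' (by simpa using hm)
  have ho : orderOf (g ^ m) = 8 := by
    rw [orderOf_pow_of_dvd hm0 ⟨8, by rw [hm]; ring⟩, hm]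
    exact Nat.mul_div_cancel _ (Nat.pos_of_ne_zero hm0)
  have hfac : (Nat.card G).factorization 2 = 3 := by
    rw [hG, show (1320:ℕ) = 2 ^ 3 * 165 by norm_num]
    rw [Nat.factorization_mul (by norm_num) (by norm_num), Finsupp.add_apply,
      Nat.factorization_pow]
    simp [Nat.factorization_eq_zero_of_not_dvd (n := 165) (p := 2) (by norm_num), Nat.Prime.factorization_self Nat.prime_two]
  have hcard : Nat.card (Subgroup.zpowers (g ^ m)) = 2 ^ (Nat.card G).factorization 2 := by
    rw [Nat.card_zpowers, ho, hfac]; norm_num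
  let S : Sylow 2 G := Sylow.ofCard (Subgroup.zpowers (g ^ m)) hcard
  have hS : IsCyclic S := by
    change IsCyclic (Subgroup.zpowers (g ^ m)); infer_instance
  have hmf : (Nat.card G).minFac = 2 := by rw [hG]; norm_num
  have hcomp := IsCyclic.isComplement' hmf hS
  set K := (MonoidHom.transferSylow S (hS.normalizer_le_centralizer hmf)).ker with hKdef
  have hK : Nat.card K = 165 := by
    have h1 := hcomp.card_mul_card
    have h2 : Nat.card (S : Subgroup G) = 8 := by
      change Nat.card (Subgroup.zpowers (g ^ m)) = 8; rw [Nat.card_zpowers, ho]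
    rw [h2, hG] at h1; omega
  have hKn : K.Normal := by rw [hKdef]; infer_instance
  obtain ⟨P⟩ : Nonempty (Sylow 11 K) := inferInstance
  have hPn := unique_sylow K hK P
  have hP : Nat.card P = 11 := exists_sylow_card (by rw [hK]; norm_num) (by rw [hK]; norm_num) P
  have hchar : (P : Subgroup K).Characteristic := Sylow.characteristic_of_normal P hPn
  let R : Subgroup G := (P : Subgroup K).map K.subtype
  have hR : R.Normal := inferInstance
  have hRc : Nat.card R = 11 := by
    rw [← hP]
    exact (Nat.card_congr ((P : Subgroup K).equivMapOfInjective K.subtype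
      K.subtype_injective).toEquiv).symm
  obtain ⟨d, hd, hc⟩ := card_normalizer hα R hRc
  rw [Subgroup.normalizer_eq_top, Subgroup.card_top, hG] at hc
  have : d ≤ 10 := Nat.le_of_dvd (by norm_num) hd
  omega

lemma card_7920 (hα : Nat.card α = 11) (hd : 1320 ∣ Nat.card G) (hle : Nat.card G ≤ 7920)
    (g : G) (hg : 8 ∣ orderOf g) : Nat.card G = 7920 ∧ ∀ P : Sylow 11 G, Nat.card P = 11 ∧
      Nat.card (Subgroup.normalizer (P : Set G)) = 55 := by
  have : Fact (Nat.Prime 11) := ⟨by norm_num⟩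
  obtain ⟨k, hk⟩ := hd
  have hpos : 0 < Nat.card G := Nat.card_pos
  have hk6 : k ≤ 6 := by omega
  have hS : ∀ P : Sylow 11 G, Nat.card P = 11 := exists_sylow_card (by omega) (by omega)
  have key : ∀ P : Sylow 11 G, k = 6 ∧ Nat.card (Subgroup.normalizer (P : Set G)) = 55 := by
    intro P
    obtain ⟨d, n, hd, hc, _, h1, h2⟩ := sylow_count hα P (hS P)
    have hd10 : d ≤ 10 := Nat.le_of_dvd (by norm_num) hd
    have hk1 : k ≠ 1 := by
      rintro rfl
      exact not_1320 hα (by omega) g hg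
    rw [hc]
    have hd' : d = 1 ∨ d = 2 ∨ d = 5 ∨ d = 10 := by
      interval_cases d <;> simp_all
    rcases hd' with rfl | rfl | rfl | rfl <;> omega
  obtain ⟨P⟩ : Nonempty (Sylow 11 G) := inferInstance
  exact ⟨by rw [hk, (key P).1], fun P => ⟨hS P, (key P).2⟩⟩

lemma simple_of (hα : Nat.card α = 11) (hd : 1320 ∣ Nat.card G) (hle : Nat.card G ≤ 7920)
    (g : G) (hg : 8 ∣ orderOf g) : IsSimpleGroup G := by
  have : Fact (Nat.Prime 11) := ⟨by norm_num⟩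
  obtain ⟨hG, hS⟩ := card_7920 hα hd hle g hg
  have : Nontrivial G := Finite.one_lt_card_iff_nontrivial.1 (by omega)
  obtain ⟨P₀⟩ : Nonempty (Sylow 11 G) := inferInstance
  refine ⟨fun N hNn => ?_⟩
  by_cases hN : N = ⊥
  · exact Or.inl hN
  right
  have h11 := eleven_dvd_normal hα (P₀ : Subgroup G) (hS P₀).1 N hN
  have hNd : Nat.card N ∣ 7920 := hG ▸ Subgroup.card_subgroup_dvd_card N
  obtain ⟨P⟩ : Nonempty (Sylow 11 N) := inferInstance
  have hP : Nat.card P = 11 := exists_sylow_card h11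
    (fun h => by have := h.trans hNd; omega) P
  obtain ⟨d, n, hd10, hc, hidx, hmul, hmod⟩ := sylow_count (G := N) hα P hP
  -- Frattini
  let R : Subgroup G := (P : Subgroup N).map N.subtype
  have hRc : Nat.card R = 11 := by
    rw [← hP]
    exact (Nat.card_congr ((P : Subgroup N).equivMapOfInjective N.subtype
      N.subtype_injective).toEquiv).symm
  have hfr := Sylow.normalizer_sup_eq_top P
  obtain ⟨e, he10, hec⟩ := card_normalizer hα R hRc
  have hle1 : N.index ∣ Nat.card (Subgroup.normalizer (R : Set G)) := by
    rw [← Subgroup.relIndex_top_right, ← hfr, Subgroup.relIndex_sup_right]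
    exact Subgroup.relIndex_dvd_card _ _
  have hidx2 := Subgroup.card_mul_index N
  have hj : N.index ∣ 10 := by
    rw [hec] at hle1
    refine Nat.Coprime.dvd_of_dvd_mul_left (m := 11) ?_ (hle1.trans (Nat.mul_dvd_mul_left 11 he10))
    rw [Nat.coprime_comm, Nat.Prime.coprime_iff_not_dvd (by norm_num)]
    rintro ⟨c, hc⟩
    obtain ⟨b, hb⟩ := h11
    rw [hb, hc, hG] at hidx2
    have : 121 ∣ 7920 := ⟨b * c, by rw [← hidx2]; ring⟩
    norm_num at this
  rw [← hmul, hG] at hidx2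
  generalize hjj : N.index = j at *
  have hj10 : j ≤ 10 := Nat.le_of_dvd (by norm_num) hj
  have hd10' : d ≤ 10 := Nat.le_of_dvd (by norm_num) hd10
  have hj' : j = 1 ∨ j = 2 ∨ j = 5 ∨ j = 10 := by interval_cases j <;> simp_all
  have hd' : d = 1 ∨ d = 2 ∨ d = 5 ∨ d = 10 := by interval_cases d <;> simp_all
  have hfin : j = 1 ∨ (j = 5 ∧ d = 1) := by
    rcases hj' with rfl | rfl | rfl | rfl <;> rcases hd' with rfl | rfl | rfl | rfl <;> omega
  rcases hfin with rfl | ⟨rfl, rfl⟩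
  · exact Subgroup.index_eq_one.1 hjj
  exfalso
  have hPN : Subgroup.normalizer (P : Set N) = (P : Subgroup N) := by
    symm
    apply Subgroup.eq_of_le_of_card_ge Subgroup.le_normalizer
    exact (hc.trans hP.symm).le
  have hcyc : IsCyclic P := isCyclic_of_prime_card hP
  have hle : Subgroup.normalizer (P : Set N) ≤ Subgroup.centralizer (P : Set N) := by
    rw [hPN]
    intro a ha b hb
    let := hcyc.commGroup
    exact congrArg Subtype.val (mul_comm (⟨b, hb⟩ : P) ⟨a, ha⟩)
  have hcomp := MonoidHom.ker_transferSylow_isComplement' P hle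
  set K := (MonoidHom.transferSylow P hle).ker with hKdef
  have hK : Nat.card K = 144 := by
    have h1 := hcomp.card_mul_card
    have h2 : Nat.card (P : Subgroup N) = 11 := hP
    rw [h2] at h1; omega
  have hKn : K.Normal := by rw [hKdef]; infer_instance
  have := eleven_dvd_normal hα (P : Subgroup N) hP K (by
    intro h; rw [h] at hK; simp at hK)
  rw [hK] at this
  norm_num at this
end Grp
end M11

namespace M11
section Frob

lemma exists_frob (A K L : Type) [CommRing A] [IsDomain A] [IsIntegrallyClosed A]
    [IsNoetherianRing A] [Field K] [Field L] [Algebra A K] [IsFractionRing A K] [Algebra K L]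
    [Algebra A L] [IsScalarTower A K L] [FiniteDimensional K L] [IsGalois K L]
    (p : ℕ) [Fact p.Prime] (ψ : A →+* ZMod p) (hψ : Function.Surjective ψ) :
    ∃ (k : Type) (_ : Field k) (_ : CharP k p) (φ : integralClosure A L →+* k) (σ : L ≃ₐ[K] L),
      (∀ a, φ (algebraMap A _ a) = ZMod.castHom dvd_rfl k (ψ a)) ∧
      ∀ x y : integralClosure A L, (y : L) = σ (x : L) → φ y = φ x ^ p := by
  let B := integralClosure A L
  have : Module.Finite A B := IsIntegralClosure.finite A K L B
  have : IsFractionRing B L := integralClosure.isFractionRing_of_finite_extension K L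
  have : FaithfulSMul A L := FaithfulSMul.trans A K L
  have hP : (RingHom.ker ψ).IsMaximal := RingHom.ker_isMaximal_of_surjective ψ hψ
  have hinj : Function.Injective (algebraMap A B) := FaithfulSMul.algebraMap_injective A B
  obtain ⟨Q, hQ, hQP⟩ := Ideal.exists_ideal_over_maximal_of_isIntegral (S := B) (RingHom.ker ψ)
    (by rw [(RingHom.injective_iff_ker_eq_bot _).1 hinj]; exact bot_le)
  let e : A ⧸ RingHom.ker ψ ≃+* ZMod p := RingHom.quotientKerEquivOfSurjective hψ
  have hfin : Finite (A ⧸ RingHom.ker ψ) := Finite.of_equiv _ e.symm.toEquiv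
  have hu : Q.under A = RingHom.ker ψ := hQP
  have hfin' : Finite (A ⧸ Q.under A) := by rw [hu]; exact hfin
  have hcard : Nat.card (A ⧸ Q.under A) = p := by
    rw [hu, Nat.card_congr e.toEquiv, Nat.card_zmod]
  have hmf : Module.Finite (A ⧸ Q.under A) (B ⧸ Q) := inferInstance
  have hfinQ : Finite (B ⧸ Q) := Module.finite_of_finite (A ⧸ Q.under A)
  let := IsIntegralClosure.MulSemiringAction A K L B
  have hinv := Algebra.isInvariant_of_isGalois A K L B
  have hsc : SMulCommClass (L ≃ₐ[K] L) A B := by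
    constructor
    intro g a b
    exact map_smul (galRestrict A K L B g) a b
  obtain ⟨σ, hσ⟩ := IsArithFrobAt.exists_of_isInvariant A (L ≃ₐ[K] L) Q
  let f : ZMod p →+* B ⧸ Q :=
    (Ideal.quotientMap Q (algebraMap A B) (le_of_eq hQP.symm)).comp (e.symm : ZMod p →+* _)
  let : Field (B ⧸ Q) := Ideal.Quotient.field Q
  have hchar : CharP (B ⧸ Q) p := charP_of_injective_ringHom f.injective p
  refine ⟨B ⧸ Q, inferInstance, hchar, Ideal.Quotient.mk Q, σ, ?_, ?_⟩
  · intro a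
    have h1 : ZMod.castHom dvd_rfl (B ⧸ Q) = f := Subsingleton.elim _ _
    rw [h1]
    have h2 : e.symm (ψ a) = Ideal.Quotient.mk _ a := by
      rw [RingEquiv.symm_apply_eq]; rfl
    change _ = (Ideal.quotientMap Q (algebraMap A B) (le_of_eq hQP.symm)) (e.symm (ψ a))
    rw [h2, Ideal.quotientMap_mk]
  · intro x y hxy
    have h1 : y = σ • x := by
      apply Subtype.ext
      rw [hxy]
      exact (algebraMap_galRestrict_apply A σ x).symm
    have h2 := hσ.mk_apply x
    rw [hcard] at h2
    rw [h1]
    exact h2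

noncomputable def emb : ℤ[X] →+* RatFunc ℚ :=
  (algebraMap ℚ[X] (RatFunc ℚ)).comp (mapRingHom (Int.castRingHom ℚ))

lemma emb_inj : Function.Injective emb := by
  apply (RatFunc.algebraMap_injective ℚ).comp
  exact map_injective _ Int.cast_injective

lemma exists_int (p : ℚ[X]) : ∃ (b : ℤ) (P : ℤ[X]), b ≠ 0 ∧
    mapRingHom (Int.castRingHom ℚ) P = (b : ℚ[X]) * p := by
  obtain ⟨b, hb, h⟩ := IsLocalization.integerNormalization_spec (nonZeroDivisors ℤ) p
  refine ⟨b, IsLocalization.integerNormalization (nonZeroDivisors ℤ) p, nonZeroDivisors.ne_zero hb, ?_⟩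
  rw [zsmul_eq_mul] at h
  exact h

lemma emb_surj (z : RatFunc ℚ) : ∃ x y, z = emb x / emb y := by
  induction z using RatFunc.induction_on with
  | f p q hq =>
    obtain ⟨b, P, hb, hP⟩ := exists_int p
    obtain ⟨c, Q, hc, hQ⟩ := exists_int q
    have h1 : (algebraMap ℚ[X] (RatFunc ℚ)) q ≠ 0 := RatFunc.algebraMap_ne_zero hq
    refine ⟨(c : ℤ[X]) * P, (b : ℤ[X]) * Q, ?_⟩
    have hb' : (b : RatFunc ℚ) ≠ 0 := by exact_mod_cast hb
    have hc' : (c : RatFunc ℚ) ≠ 0 := by exact_mod_cast hc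
    simp only [emb, RingHom.comp_apply, map_mul, hP, hQ, map_intCast]
    field_simp

/-- reduction data -/
theorem exists_place (L : Type) [Field L] [Algebra (RatFunc ℚ) L] [FiniteDimensional (RatFunc ℚ) L]
    [IsGalois (RatFunc ℚ) L] (p : ℕ) [Fact p.Prime] (t₀ : ℤ) :
    ∃ (B : Subring L) (k : Type) (_ : Field k) (_ : CharP k p) (φ : B →+* k)
      (σ : L ≃ₐ[RatFunc ℚ] L),
      (∀ x : L, ∀ f : ℤ[X][X], f.Monic →
        eval₂ ((algebraMap (RatFunc ℚ) L).comp emb) x f = 0 → x ∈ B) ∧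
      (∀ x : B, (x : L) = algebraMap (RatFunc ℚ) L RatFunc.X → φ x = (t₀ : k)) ∧
      ∀ x y : B, (y : L) = σ (x : L) → φ y = φ x ^ p := by
  let : Algebra ℤ[X] (RatFunc ℚ) := emb.toAlgebra
  let : Algebra ℤ[X] L := ((algebraMap (RatFunc ℚ) L).comp emb).toAlgebra
  have : IsScalarTower ℤ[X] (RatFunc ℚ) L := IsScalarTower.of_algebraMap_eq fun _ => rfl
  have : FaithfulSMul ℤ[X] (RatFunc ℚ) := (faithfulSMul_iff_algebraMap_injective _ _).2 emb_inj
  have : IsFractionRing ℤ[X] (RatFunc ℚ) := IsFractionRing.of_field _ _ emb_surj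
  let ψ : ℤ[X] →+* ZMod p := eval₂RingHom (Int.castRingHom _) (t₀ : ZMod p)
  have hψ : Function.Surjective ψ := by
    intro z
    obtain ⟨n, rfl⟩ := ZMod.intCast_surjective z
    exact ⟨n, by simp⟩
  obtain ⟨k, i1, i2, φ, σ, h1, h2⟩ := exists_frob ℤ[X] (RatFunc ℚ) L p ψ hψ
  refine ⟨(integralClosure ℤ[X] L).toSubring, k, i1, i2, φ, σ, ?_, ?_, h2⟩
  · intro x f hf hx
    exact ⟨f, hf, hx⟩
  · intro x hx
    have h3 : x = algebraMap ℤ[X] (integralClosure ℤ[X] L) X := by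
      apply Subtype.ext
      rw [hx]
      change _ = algebraMap (RatFunc ℚ) L (emb X)
      simp [emb]
    rw [h3]
    refine (h1 X).trans ?_
    simp [ψ]
end Frob
end M11

namespace M11
section Comb
def rowsN : List ℕ := [435, 1145, 1701, 2659, 1803, 3095, 2713, 853, 2349, 3521, 207]
def mt (i j : ℕ) : Bool := (rowsN.getD i 0).testBit j
def rl (i j i' j' j0 : ℕ) : Bool := (mt i j ^^ mt i 0) == (mt i' j' ^^ mt i' j0)
def leafOk (pre : List ℕ) : Bool := (List.range 11).all fun i => (List.range 11).all fun i' =>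
  i == i' || (List.range 12).any fun j => !(rl i j i' (pre.getD j 0) (pre.getD 0 0))
def dfs : ℕ → List ℕ → Bool
  | 0, pre => leafOk pre
  | f + 1, pre => (List.range 12).all fun c => pre.contains c ||
      (List.range 4).any (fun i => !(rl i pre.length i c ((pre ++ [c]).getD 0 0))) ||
      dfs f (pre ++ [c])

lemma dfs_true : dfs 12 [] = true := by decide +kernel

lemma dfs_sound (τ : ℕ → ℕ) (hlt : ∀ j < 12, τ j < 12)
    (hinj : ∀ j < 12, ∀ k < 12, τ j = τ k → j = k)
    (hb : ∀ i < 4, ∀ j < 12, rl i j i (τ j) (τ 0) = true) :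
    ∀ f n, n + f = 12 → dfs f ((List.range n).map τ) = true →
      leafOk ((List.range 12).map τ) = true := by
  intro f
  induction f with
  | zero => intro n hn h; rw [show n = 12 by omega] at h; exact h
  | succ f ih =>
    intro n hn h
    apply ih (n + 1) (by omega)
    rw [dfs, List.all_eq_true] at h
    have h1 := h (τ n) (List.mem_range.2 (hlt n (by omega)))
    have h2 : ((List.range n).map τ ++ [τ n]) = (List.range (n + 1)).map τ := by
      rw [List.range_succ, List.map_append]; rfl
    rw [h2] at h1
    simp only [Bool.or_eq_true] at h1
    rcases h1 with (h1 | h1) | h1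
    · exfalso
      rw [List.contains_iff_mem, List.mem_map] at h1
      obtain ⟨j, hj, hjn⟩ := h1
      rw [List.mem_range] at hj
      have := hinj j (by omega) n (by omega) hjn
      omega
    · exfalso
      rw [List.any_eq_true] at h1
      obtain ⟨i, hi, h1⟩ := h1
      have h3 : ((List.range (n + 1)).map τ).getD 0 0 = τ 0 := by
        simp [List.getD]
      rw [h3] at h1
      have := hb i (List.mem_range.1 hi) n (by omega)
      simp [this] at h1
    · exact h1

lemma comb (π : Fin 11 → Fin 11) (τ : Fin 12 → Fin 12) (hτ : Function.Injective τ)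
    (hrel : ∀ (i : Fin 11) (j k : Fin 12), mt i j = mt i k ↔ mt (π i) (τ j) = mt (π i) (τ k))
    (h0 : π 0 = 0) (h1 : π 1 = 1) (h2 : π 2 = 2) (h3 : π 3 = 3) (i : Fin 11) : π i = i := by
  let τ' : ℕ → ℕ := fun j => if hj : j < 12 then τ ⟨j, hj⟩ else 0
  have hτ' : ∀ j : Fin 12, τ' j = τ j := fun j => by simp [τ']
  have hr : ∀ (i : Fin 11) (j : Fin 12), rl i j (π i) (τ' j) (τ' 0) = true := by
    intro i j
    have h := hrel i j 0
    have e0 : τ' 0 = τ 0 := hτ' 0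
    rw [hτ', e0, rl, beq_iff_eq]
    have e0 : ((0 : Fin 12) : ℕ) = 0 := rfl
    rw [e0] at h
    revert h
    cases mt i j <;> cases mt i 0 <;> cases mt (π i) (τ j) <;> cases mt (π i) (τ 0) <;> simp
  have hleaf := dfs_sound τ' (fun j hj => by simp [τ', hj])
    (fun j hj k hk h => by
      have e1 := hτ' ⟨j, hj⟩
      have e2 := hτ' ⟨k, hk⟩
      simp only at e1 e2
      rw [e1, e2] at h
      have := hτ (Fin.ext h)
      simpa using this)
    (fun i hi j hj => by
      interval_cases i
      · have := hr 0 ⟨j, hj⟩; rw [h0] at this; exact this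
      · have := hr 1 ⟨j, hj⟩; rw [h1] at this; exact this
      · have := hr 2 ⟨j, hj⟩; rw [h2] at this; exact this
      · have := hr 3 ⟨j, hj⟩; rw [h3] at this; exact this) 12 0 rfl dfs_true
  rw [leafOk, List.all_eq_true] at hleaf
  have h4 := hleaf i (List.mem_range.2 i.2)
  rw [List.all_eq_true] at h4
  have h5 := h4 (π i) (List.mem_range.2 (π i).2)
  simp only [Bool.or_eq_true, beq_iff_eq] at h5
  rcases h5 with h5 | h5
  · exact (Fin.ext h5).symm
  · exfalso
    rw [List.any_eq_true] at h5
    obtain ⟨j, hj, h5⟩ := h5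
    rw [List.mem_range] at hj
    have h6 := hr i ⟨j, hj⟩
    simp only at h6
    have e1 : ((List.range 12).map τ').getD j 0 = τ' j := by
      simp [List.getD, hj]
    have e2 : ((List.range 12).map τ').getD 0 0 = τ' 0 := by
      simp [List.getD]
    rw [e1, e2, h6] at h5
    simp at h5
end Comb
end M11

namespace M11

section Ident
def PP {R : Type*} [CommRing R] (a b y : R) : R :=
  (80*a + 80*b + (-64)) * y^6 +
    ((-7875)*a^3 + 4500*a^2*b + 1800*a^2 + 2250*a*b^2 + 2250*a*b + (-4740)*a + (-3600)*b^2 + 2640*b + 840) * y^4 +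
    ((-9000)*a^3 + (-4500)*a^2*b + 5400*a^2 + 4500*a*b^2 + (-4500)*a*b + 360*a) * y^3 +
    (24750*a^3 + (-4500)*a^2*b + (-9000)*a^2 + (-9000)*a*b^2 + 7200*a + 3600*b^2 + (-3600)) * y^2 +
    (9000*a^3 + 4500*a^2*b + (-9000)*a^2 + (-4500)*a*b^2 + 4500*a*b + (-1800)*a) * y^1 +
    ((-16875)*a^3 + 10800*a^2 + 6750*a*b^2 + (-2250)*a*b + 500*a + (-4000)*b + 5000) * y^0
def QQ {R : Type*} [CommRing R] (a b y : R) : R :=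
  (1800*a^2 + (-1440)*a + (-1800)*b^2 + 1440*b) * y^5 +
    ((-3375)*a^3 + (-6750)*a^2*b + 8550*a^2 + 6750*a*b^2 + (-7650)*a*b + 180*a) * y^4 +
    ((-13500)*a^3 + 13500*a^2*b + (-21600)*a^2 + (-13500)*a*b^2 + 33300*a*b + (-10800)*a + (-7200)*b^2 + 10800*b) * y^3 +
    (20250*a^3 + (-9900)*a^2 + 3600*a*b + (-1800)*a) * y^2 +
    (13500*a^3 + (-13500)*a^2*b + 23400*a^2 + 13500*a*b^2 + (-40500)*a*b + 18000*a + 9000*b^2 + (-18000)*b) * y^1 +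
    ((-16875)*a^3 + 6750*a^2*b + (-2250)*a^2 + (-6750)*a*b^2 + 11250*a*b + 4500*a) * y^0
def NN {R : Type*} [CommRing R] (a t : R) : R :=
  (-270)*a^6 + (-45)*a^5 + (-135)*a^3*t + (-117)*a^2*t + 20*a*t + 20*t
def DD {R : Type*} [CommRing R] (a t : R) : R :=
  (-135)*a^5 + 135*a^2*t + (-20)*t
def f12 {R : Type*} [CommRing R] (y t : R) : R :=
  10125*t*(y^2-1)^3*((y+1)^3-16) + 4*(y^2-5)^5*(4*y^2-5)

lemma cubic_rel {L : Type*} [Field L] [CharZero L] (a t b : L)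
    (hh : 1*a^11 + 3*a^8*t + 2*a^7*t + 3*a^5*t^2 + (14/5)*a^4*t^2 + (4/5)*a^3*t^2 + (-1)*a^2*t^3 + (-40/81)*a^2*t^2 + (-16/81)*a*t^2 + (4/25)*t^3 = 0)
    (hD : DD a t ≠ 0) (hb : b = NN a t / DD a t) :
    25*a^3 + (-30)*a^2*b + 8*a^2 + (-10)*a*b + 10*a + 10*b^3 + (-10)*b = 0 ∧ t * ((1/3)*a^2 + (-4/3)*a*b + (-2/9)*a + (-2/3)*b^2 + (-2/9)*b + (4/9)) = a^5 := by
  have hbD : b * DD a t = NN a t := by rw [hb]; field_simp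
  constructor
  · apply mul_left_cancel₀ (pow_ne_zero 3 hD)
    have e2 : b^2 * DD a t^2 = NN a t^2 := by rw [← hbD]; ring
    have e3 : b^3 * DD a t^3 = NN a t^3 := by rw [← hbD]; ring
    have key : 10*NN a t^3 + (-30*a^2-10*a-10)*NN a t*DD a t^2+(25*a^3+8*a^2+10*a)*DD a t^3 = 0 := by
      unfold NN DD
      linear_combination ((-110716875)*a^7 + (-44286750)*a^6 + 16402500*a^5 + 7290000*a^4) * hh
    linear_combination key + 10*e3 + (-30*a^2-10*a-10)*DD a t^2*hbD
  · apply mul_left_cancel₀ (pow_ne_zero 2 hD)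
    have e2 : b^2 * DD a t^2 = NN a t^2 := by rw [← hbD]; ring
    have key : t*((4/9-2/9*a+1/3*a^2)*DD a t^2 + (-2/9-4/3*a)*NN a t*DD a t - 2/3*NN a t^2) = a^5*DD a t^2 := by
      unfold NN DD
      linear_combination ((-18225)*a^4) * hh
    linear_combination key - 2/3*t*e2 + (-2/9-4/3*a)*t*DD a t*hbD

set_option maxHeartbeats 4000000 in
lemma PQ_rel {L : Type*} [Field L] [CharZero L] (a t b y : L)
    (hc : 25*a^3 + (-30)*a^2*b + 8*a^2 + (-10)*a*b + 10*a + 10*b^3 + (-10)*b = 0) (hX : t * ((1/3)*a^2 + (-4/3)*a*b + (-2/9)*a + (-2/3)*b^2 + (-2/9)*b + (4/9)) = a^5) (ha : a ≠ 0)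
    (hf : f12 y t = 0) :
    45 * (b - a) * PP a b y ^ 2 = (5*a+5*b-4) * QQ a b y ^ 2 := by
  have hX0 : (1/3)*a^2 + (-4/3)*a*b + (-2/9)*a + (-2/3)*b^2 + (-2/9)*b + (4/9) ≠ 0 := by
    intro h0
    rw [h0, mul_zero] at hX
    exact ha (pow_eq_zero_iff (by norm_num) |>.1 hX.symm)
  apply mul_left_cancel₀ hX0
  unfold f12 at hf
  unfold PP QQ
  linear_combination (((-189843750)*a^6 + 698625000*a^5*b + 525487500*a^5 + 683437500*a^4*b^2 + (-713812500)*a^4*b + (-718875000)*a^4 + (-121500000)*a^3*b^3 + (-558900000)*a^3*b^2 + (-360450000)*a^3*b + 513900000*a^3 + (-121500000)*a^2*b^4 + (-12150000)*a^2*b^3 + 157950000*a^2*b^2 + 165600000*a^2*b + (-49500000)*a^2 + 162000000*a*b^3 + (-202500000)*a*b^2 + 225000000*a*b + (-63000000)*a + 27000000*b^2 + 9000000*b + (-18000000)) * y^0 +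
    (212625000*a^6 + (-698625000)*a^5*b + (-498150000)*a^5 + (-1093500000)*a^4*b^2 + 992250000*a^4*b + 639360000*a^4 + (-60750000)*a^3*b^3 + 814050000*a^3*b^2 + 108540000*a^3*b + (-486000000)*a^3 + 121500000*a^2*b^4 + 48600000*a^2*b^3 + (-24300000)*a^2*b^2 + (-264600000)*a^2*b + 86400000*a^2 + (-40500000)*a*b^4 + 59400000*a*b^3 + 27000000*a*b^2 + (-129600000)*a*b + 64800000*a) * y^1 +
    (486000000*a^6 + (-1913625000)*a^5*b + (-1320300000)*a^5 + (-1275750000)*a^4*b^2 + 1449900000*a^4*b + 1940220000*a^4 + 668250000*a^3*b^3 + 976050000*a^3*b^2 + 774900000*a^3*b + (-1398240000)*a^3 + 364500000*a^2*b^4 + (-291600000)*a^2*b^3 + (-749520000)*a^2*b^2 + 137160000*a^2*b + 200880000*a^2 + (-64800000)*a*b^4 + (-577800000)*a*b^3 + 853200000*a*b^2 + (-453600000)*a*b + 43200000*a + 27000000*b^4 + (-34200000)*b^3 + (-54000000)*b^2 + 21600000*b + 14400000) * y^2 +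
    ((-516375000)*a^6 + 1731375000*a^5*b + 1113750000*a^5 + 2551500000*a^4*b^2 + (-2134350000)*a^4*b + (-1433160000)*a^4 + (-60750000)*a^3*b^3 + (-1356750000)*a^3*b^2 + (-370980000)*a^3*b + 1082160000*a^3 + (-364500000)*a^2*b^4 + 162000000*a^2*b^3 + 215460000*a^2*b^2 + 175320000*a^2*b + (-174240000)*a^2 + 129600000*a*b^4 + (-52920000)*a*b^3 + (-219960000)*a*b^2 + 224640000*a*b + (-61920000)*a) * y^3 +
    ((-440437500)*a^6 + 1913625000*a^5*b + 1212975000*a^5 + 455625000*a^4*b^2 + (-1022625000)*a^4*b + (-2005830000)*a^4 + (-1032750000)*a^3*b^3 + (-854550000)*a^3*b^2 + (-79920000)*a^3*b + 1440000000*a^3 + (-364500000)*a^2*b^4 + 591300000*a^2*b^3 + 1034640000*a^2*b^2 + (-402480000)*a^2*b + (-395640000)*a^2 + 194400000*a*b^4 + 564840000*a*b^3 + (-1103040000)*a*b^2 + 460080000*a*b + 38160000*a + (-82080000)*b^4 + 72000000*b^3 + 94320000*b^2 + (-64080000)*b + (-4320000)) * y^4 +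
    (394875000*a^6 + (-1366875000)*a^5*b + (-789750000)*a^5 + (-1822500000)*a^4*b^2 + 1502550000*a^4*b + 1051920000*a^4 + 303750000*a^3*b^3 + 660150000*a^3*b^2 + 139860000*a^3*b + (-766656000)*a^3 + 364500000*a^2*b^4 + (-356400000)*a^2*b^3 + (-314820000)*a^2*b^2 + 65304000*a^2*b + 146304000*a^2 + (-145800000)*a*b^4 + 14040000*a*b^3 + 238392000*a*b^2 + (-147456000)*a*b + 16992000*a) * y^5 +
    (182250000*a^6 + (-880875000)*a^5*b + (-502200000)*a^5 + 182250000*a^4*b^2 + 356400000*a^4*b + 937440000*a^4 + 546750000*a^3*b^3 + 627750000*a^3*b^2 + (-431460000)*a^3*b + (-684072000)*a^3 + 121500000*a^2*b^4 + (-388800000)*a^2*b^3 + (-462780000)*a^2*b^2 + 206352000*a^2*b + 302400000*a^2 + (-194400000)*a*b^4 + (-111240000)*a*b^3 + 578088000*a*b^2 + (-249696000)*a*b + (-51264000)*a + 84240000*b^4 + (-55728000)*b^3 + (-84960000)*b^2 + 55584000*b + 576000) * y^6 +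
    ((-91125000)*a^6 + 334125000*a^5*b + 166050000*a^5 + 364500000*a^4*b^2 + (-376650000)*a^4*b + (-223560000)*a^4 + (-182250000)*a^3*b^3 + (-117450000)*a^3*b^2 + 70740000*a^3*b + 160560000*a^3 + (-121500000)*a^2*b^4 + 162000000*a^2*b^3 + 71820000*a^2*b^2 + (-42840000)*a^2*b + (-41760000)*a^2 + 64800000*a*b^4 + (-37800000)*a*b^3 + (-60840000)*a*b^2 + 40320000*a*b + (-1440000)*a) * y^7 +
    ((-37968750)*a^6 + 182250000*a^5*b + 84037500*a^5 + (-45562500)*a^4*b^2 + (-69862500)*a^4*b + (-170775000)*a^4 + (-60750000)*a^3*b^3 + (-190350000)*a^3*b^2 + 168210000*a^3*b + 126900000*a^3 + 101250000*a^2*b^3 + 55890000*a^2*b^2 + (-41616000)*a^2*b + (-78501600)*a^2 + 64800000*a*b^4 + (-39960000)*a*b^3 + (-97596000)*a*b^2 + 49550400*a*b + 18734400*a + (-30240000)*b^4 + 18432000*b^3 + 29707200*b^2 + (-18993600)*b + (-28800)) * y^8 +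
    (8100000*a^5 + 16200000*a^4*b + (-17280000)*a^4 + (-17280000)*a^3*b + 12240000*a^3 + (-16200000)*a^2*b^3 + 17280000*a^2*b^2 + (-2880000)*a^2 + (-8100000)*a*b^4 + 17280000*a*b^3 + (-12240000)*a*b^2 + 2880000*a*b) * y^9 +
    (540000*a^4 + (-2160000)*a^3*b + (-792000)*a^3 + (-1620000)*a^2*b^2 + 1800000*a^2*b + 1008000*a^2 + 2160000*a*b^3 + (-504000)*a*b^2 + (-576000)*a + 1080000*b^4 + (-504000)*b^3 + (-1008000)*b^2 + 576000*b) * y^10) * hc +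
    720*(b-a)*(5*a+5*b-4)^2*(((1/3)*a^2 + (-4/3)*a*b + (-2/9)*a + (-2/3)*b^2 + (-2/9)*b + (4/9))*hf - 10125*(y^2-1)^3*((y+1)^3-16)*hX)
end Ident

end M11

namespace M11
section ValSec
variable {L k : Type} [Field L] [Field k] {B : Subring L} {φ : B →+* k}

/-- `x` is regular at the place and has residue `c` -/
def Val (φ : B →+* k) (x : L) (c : k) : Prop :=
  ∃ u v : B, φ v ≠ 0 ∧ x * v = u ∧ c * φ v = φ u

lemma val_mem (x : B) : Val φ (x : L) (φ x) := ⟨x, 1, by simp, by simp, by simp⟩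

lemma val_add {x y : L} {c d : k} (h1 : Val φ x c) (h2 : Val φ y d) : Val φ (x + y) (c + d) := by
  obtain ⟨u, v, a1, a2, a3⟩ := h1
  obtain ⟨u', v', b1, b2, b3⟩ := h2
  refine ⟨u * v' + u' * v, v * v', ?_, ?_, ?_⟩
  · rw [map_mul]; exact mul_ne_zero a1 b1
  · push_cast; rw [← a2, ← b2]; ring
  · simp only [map_mul, map_add]; rw [← a3, ← b3]; ring

lemma val_mul {x y : L} {c d : k} (h1 : Val φ x c) (h2 : Val φ y d) : Val φ (x * y) (c * d) := by
  obtain ⟨u, v, a1, a2, a3⟩ := h1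
  obtain ⟨u', v', b1, b2, b3⟩ := h2
  refine ⟨u * u', v * v', ?_, ?_, ?_⟩
  · rw [map_mul]; exact mul_ne_zero a1 b1
  · push_cast; rw [← a2, ← b2]; ring
  · simp only [map_mul]; rw [← a3, ← b3]; ring

lemma val_neg {x : L} {c : k} (h1 : Val φ x c) : Val φ (-x) (-c) := by
  obtain ⟨u, v, a1, a2, a3⟩ := h1
  refine ⟨-u, v, a1, ?_, ?_⟩
  · push_cast; rw [← a2]; ring
  · rw [map_neg, ← a3]; ring

lemma val_sub {x y : L} {c d : k} (h1 : Val φ x c) (h2 : Val φ y d) : Val φ (x - y) (c - d) := by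
  rw [sub_eq_add_neg, sub_eq_add_neg]; exact val_add h1 (val_neg h2)

lemma val_one : Val φ (1 : L) 1 := ⟨1, 1, by simp, by simp, by simp⟩

lemma val_pow {x : L} {c : k} (h1 : Val φ x c) (n : ℕ) : Val φ (x ^ n) (c ^ n) := by
  induction n with
  | zero => simpa using val_one
  | succ n ih => rw [pow_succ, pow_succ]; exact val_mul ih h1

lemma val_num (n : ℕ) [n.AtLeastTwo] : Val φ (OfNat.ofNat n : L) (OfNat.ofNat n) :=
  ⟨OfNat.ofNat n, 1, by simp, by simp; rfl, by simpa using (map_ofNat φ n).symm⟩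

lemma val_ne {x : L} {c : k} (h1 : Val φ x c) (hc : c ≠ 0) : x ≠ 0 := by
  rintro rfl
  obtain ⟨u, v, a1, a2, a3⟩ := h1
  have : u = 0 := by apply Subtype.ext; rw [← a2]; simp
  rw [this, map_zero] at a3
  exact (mul_ne_zero hc a1) a3

lemma val_div {x y : L} {c d : k} (h1 : Val φ x c) (h2 : Val φ y d) (hd : d ≠ 0) :
    Val φ (x / y) (c / d) := by
  have hy := val_ne h2 hd
  obtain ⟨u, v, a1, a2, a3⟩ := h1
  obtain ⟨u', v', b1, b2, b3⟩ := h2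
  refine ⟨u * v', v * u', ?_, ?_, ?_⟩
  · rw [map_mul, ← b3]; exact mul_ne_zero a1 (mul_ne_zero hd b1)
  · push_cast; rw [← a2, ← b2]; field_simp
  · simp only [map_mul]; rw [← a3, ← b3]; field_simp

lemma val_PP {a b y : L} {α β η : k} (ha : Val φ a α) (hb : Val φ b β) (hy : Val φ y η) :
    Val φ (PP a b y) (PP α β η) := by
  unfold PP
  repeat' (first | exact ha | exact hb | exact hy | apply val_add | apply val_mul | apply val_pow | apply val_neg |
    exact val_num _)

lemma val_QQ {a b y : L} {α β η : k} (ha : Val φ a α) (hb : Val φ b β) (hy : Val φ y η) :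
    Val φ (QQ a b y) (QQ α β η) := by
  unfold QQ
  repeat' (first | exact ha | exact hb | exact hy | apply val_add | apply val_mul | apply val_pow | apply val_neg |
    exact val_num _)

lemma val_NN {a y : L} {α η : k} (ha : Val φ a α) (hy : Val φ y η) :
    Val φ (NN a y) (NN α η) := by
  unfold NN
  repeat' (first | exact ha | exact hy | apply val_add | apply val_mul | apply val_pow | apply val_neg |
    exact val_num _)

lemma val_DD {a y : L} {α η : k} (ha : Val φ a α) (hy : Val φ y η) :
    Val φ (DD a y) (DD α η) := by
  unfold DD
  repeat' (first | exact ha | exact hy | apply val_add | apply val_mul | apply val_pow | apply val_neg |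
    exact val_num _)

/-- a monic polynomial with all its roots in `B` factors over `B` -/
lemma exists_fact (F : B[X]) (hF : F.Monic) (hs : (F.map B.subtype).Splits)
    (hB : ∀ x : L, (F.map B.subtype).eval x = 0 → x ∈ B) :
    ∃ s : Multiset B, F = (s.map fun b => X - C b).prod := by
  have hm := hF.map B.subtype
  have h1 := hs.eq_prod_roots_of_monic hm
  have h2 : ∀ x ∈ (F.map B.subtype).roots, x ∈ B := fun x hx => hB x (isRoot_of_mem_roots hx)
  refine ⟨(F.map B.subtype).roots.pmap (fun x hx => (⟨x, hx⟩ : B)) h2, ?_⟩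
  apply map_injective B.subtype Subtype.val_injective
  refine h1.trans ?_
  rw [Polynomial.map_multiset_prod, Multiset.map_map, Multiset.map_pmap]
  congr 1
  simp [Multiset.pmap_eq_map]

lemma red_splits (F : B[X]) (hF : F.Monic) (hs : (F.map B.subtype).Splits)
    (hB : ∀ x : L, (F.map B.subtype).eval x = 0 → x ∈ B) : (F.map φ).Splits := by
  obtain ⟨s, hs⟩ := exists_fact F hF hs hB
  rw [hs, Polynomial.map_multiset_prod, Multiset.map_map]
  apply Splits.multisetProd
  intro f hf
  obtain ⟨b, _, rfl⟩ := Multiset.mem_map.1 hf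
  simp

lemma lift_root (F : B[X]) (hF : F.Monic) (hs : (F.map B.subtype).Splits)
    (hB : ∀ x : L, (F.map B.subtype).eval x = 0 → x ∈ B) (r : k) (hr : (F.map φ).eval r = 0) :
    ∃ x : B, (F.map B.subtype).eval (x : L) = 0 ∧ φ x = r := by
  obtain ⟨s, hs⟩ := exists_fact F hF hs hB
  have h1 : F.map φ = (s.map fun b => X - C (φ b)).prod := by
    rw [hs, Polynomial.map_multiset_prod, Multiset.map_map]
    congr 1
    apply Multiset.map_congr rfl
    intro b _
    simp
  rw [h1, eval_multiset_prod, Multiset.map_map, Multiset.prod_eq_zero_iff, Multiset.mem_map] at hr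
  obtain ⟨b, hb, hb0⟩ := hr
  refine ⟨b, ?_, ?_⟩
  · have : F.eval b = 0 := by
      rw [hs, eval_multiset_prod, Multiset.map_map, Multiset.prod_eq_zero_iff, Multiset.mem_map]
      exact ⟨b, hb, by simp⟩
    have h2 := eval₂_at_apply (p := F) B.subtype b
    rw [this, map_zero] at h2
    rw [eval_map]; exact h2
  · simp at hb0
    exact (sub_eq_zero.1 hb0).symm
end ValSec

section Polys
noncomputable def Hp {R : Type*} [CommRing R] (t : R) : R[X] :=
  X^11 + 10125 * C t * X^8 + 101250 * C t * X^7 + 34171875 * C t^2 * X^5 + 478406250 * C t^2 * X^4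
   + 2050312500 * C t^2 * X^3 - 18984375000 * C t^2 * X^2 - 113906250000 * C t^2 * X
   - 38443359375 * C t^3 * X^2 + 1383960937500 * C t^3

noncomputable def Fp {R : Type*} [CommRing R] (t : R) : R[X] :=
  (X^2-80)^5*(X^2-20) + 40500 * C t * (X^2-16)^3*((X+4)^3-1024)

variable {R S : Type*} [CommRing R] [CommRing S]

lemma Hp_map (f : R →+* S) (t : R) : (Hp t).map f = Hp (f t) := by
  simp [Hp]

lemma Fp_map (f : R →+* S) (t : R) : (Fp t).map f = Fp (f t) := by
  simp [Fp]

lemma Hp_monic (t : R) : (Hp t).Monic := by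
  nontriviality R
  unfold Hp
  monicity!

lemma Fp_monic (t : R) : (Fp t).Monic := by
  nontriviality R
  unfold Fp
  have h1 : ((X^2-80)^5*(X^2-20) : R[X]).Monic := by
    apply Monic.mul
    · apply Monic.pow; monicity!
    · monicity!
  have d1 : ((X^2-80)^5*(X^2-20) : R[X]).natDegree = 12 := by
    rw [Monic.natDegree_mul, Monic.natDegree_pow]
    · have e1 : (X^2-80 : R[X]).natDegree = 2 := by compute_degree!
      have e2 : (X^2-20 : R[X]).natDegree = 2 := by compute_degree!
      rw [e1, e2]
    · monicity!
    · apply Monic.pow; monicity!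
    · monicity!
  have d2 : (40500 * C t * (X^2-16)^3*((X+4)^3-1024) : R[X]).natDegree ≤ 9 := by
    compute_degree
  apply h1.add_of_left
  apply degree_lt_degree
  omega
end Polys

section FieldSec
abbrev K := RatFunc ℚ

/-- the big splitting field -/
abbrev E : Type := (h * Fp t).SplittingField

noncomputable def tE : E := algebraMap K E t

lemma h_natDegree : h.natDegree = 11 := by
  unfold h
  compute_degree!

lemma h_ne : h ≠ 0 := by
  intro h0
  have := h_natDegree
  rw [h0] at this
  simp at this

lemma hFp_ne : h * Fp t ≠ 0 := mul_ne_zero h_ne (Fp_monic t).ne_zero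

instance instGalE : IsGalois K E := by
  have : Normal K E := Normal.of_isSplittingField (h * Fp t)
  exact { }

lemma h_splits : (h.map (algebraMap K E)).Splits := by
  have h1 := SplittingField.splits (h * Fp t)
  rw [Polynomial.map_mul] at h1
  exact h1.of_dvd (by rw [← Polynomial.map_mul]; exact (Polynomial.map_ne_zero hFp_ne)) (dvd_mul_right _ _)

lemma Fp_splits : (Fp tE).Splits := by
  have h1 := SplittingField.splits (h * Fp t)
  rw [Polynomial.map_mul] at h1
  have h2 := h1.of_dvd (by rw [← Polynomial.map_mul]; exact (Polynomial.map_ne_zero hFp_ne)) (dvd_mul_left _ _)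
  rwa [Fp_map] at h2

instance instFactSplit : Fact ((h.map (algebraMap K E)).Splits) := ⟨h_splits⟩

lemma map_h' {L : Type} [Field L] (f : K →+* L) : h.map f = X ^ 11 + X ^ 7 * (3 * X + 2) * C (f t) +
    X * (3 * X ^ 4 + C (14 / 5 : L) * X ^ 3 + C (4 / 5 : L) * X ^ 2 -
      C (40 / 81 : L) * X - C (16 / 81 : L)) * C (f t) ^ 2 -
    (X - C (2 / 5 : L)) * (X + C (2 / 5 : L)) * C (f t) ^ 3 := by
  unfold h
  simp
  rw [show f 14 = 14 from map_ofNat f 14, show f 5 = 5 from map_ofNat f 5,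
    show f 4 = 4 from map_ofNat f 4, show f 40 = 40 from map_ofNat f 40,
    show f 81 = 81 from map_ofNat f 81, show f 16 = 16 from map_ofNat f 16,
    show f 2 = 2 from map_ofNat f 2]

lemma map_h : h.map (algebraMap K E) = X ^ 11 + X ^ 7 * (3 * X + 2) * C tE +
    X * (3 * X ^ 4 + C (14 / 5 : E) * X ^ 3 + C (4 / 5 : E) * X ^ 2 -
      C (40 / 81 : E) * X - C (16 / 81 : E)) * C tE ^ 2 -
    (X - C (2 / 5 : E)) * (X + C (2 / 5 : E)) * C tE ^ 3 := map_h' _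

lemma Hp_eval (a : E) : (Hp tE).eval (15 * a) = 15 ^ 11 * (h.map (algebraMap K E)).eval a := by
  rw [map_h]
  unfold Hp
  simp
  ring

lemma Hp_eq : Hp tE = C (15^11 : E) * (h.map (algebraMap K E)).comp (C (15⁻¹ : E) * X) := by
  apply Polynomial.funext
  intro x
  have := Hp_eval (15⁻¹ * x)
  rw [mul_inv_cancel_left₀ (by norm_num)] at this
  rw [this]
  simp

lemma Hp_splits : (Hp tE).Splits := by
  rw [Hp_eq]
  apply Splits.C_mul
  apply h_splits.comp_of_natDegree_le_one
  compute_degree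

lemma place (p : ℕ) [Fact p.Prime] (t₀ : ℤ) :
    ∃ (B : Subring E) (k : Type) (_ : Field k) (_ : CharP k p) (φ : B →+* k) (σ : E ≃ₐ[K] E),
      (∀ x : E, (Hp tE).eval x = 0 → x ∈ B) ∧
      (∀ r : k, (Hp (t₀ : k)).eval r = 0 → ∃ x : B, (Hp tE).eval (x : E) = 0 ∧ φ x = r) ∧
      (∀ r : k, (Fp (t₀ : k)).eval r = 0 → ∃ x : B, (Fp tE).eval (x : E) = 0 ∧ φ x = r) ∧
      (Hp (t₀ : k)).Splits ∧
      Val φ tE (t₀ : k) ∧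
      ∀ x y : B, (y : E) = σ x → φ y = φ x ^ p := by
  obtain ⟨B, k, i1, i2, φ, σ, h1, h2, h3⟩ := exists_place E p t₀
  refine ⟨B, k, i1, i2, φ, σ, ?_⟩
  have et : ((algebraMap K E).comp emb) X = tE := by
    unfold emb tE t
    simp
  have mH : ∀ x : E, (Hp tE).eval x = 0 → x ∈ B := by
    intro x hx
    apply h1 x (Hp (X : ℤ[X])) (Hp_monic _)
    rw [← eval_map, Hp_map, et, hx]
  have mF : ∀ x : E, (Fp tE).eval x = 0 → x ∈ B := by
    intro x hx
    apply h1 x (Fp (X : ℤ[X])) (Fp_monic _)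
    rw [← eval_map, Fp_map, et, hx]
  have mt : tE ∈ B := by
    apply h1 tE (X - C (X : ℤ[X])) (monic_X_sub_C _)
    rw [← eval_map, Polynomial.map_sub, map_X, map_C, et]
    simp
  have ht : φ ⟨tE, mt⟩ = (t₀ : k) := h2 _ rfl
  have eH : (Hp (⟨tE, mt⟩ : B)).map B.subtype = Hp tE := Hp_map _ _
  have eF : (Fp (⟨tE, mt⟩ : B)).map B.subtype = Fp tE := Fp_map _ _
  have eH' : (Hp (⟨tE, mt⟩ : B)).map φ = Hp (t₀ : k) := by rw [Hp_map, ht]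
  have eF' : (Fp (⟨tE, mt⟩ : B)).map φ = Fp (t₀ : k) := by rw [Fp_map, ht]
  refine ⟨mH, ?_, ?_, ?_, ?_, h3⟩
  · intro r hr
    have := lift_root (φ := φ) (Hp (⟨tE, mt⟩ : B)) (Hp_monic _) (by rw [eH]; exact Hp_splits)
      (by rw [eH]; exact mH) r (by rw [eH']; exact hr)
    rwa [eH] at this
  · intro r hr
    have := lift_root (φ := φ) (Fp (⟨tE, mt⟩ : B)) (Fp_monic _) (by rw [eF]; exact Fp_splits)
      (by rw [eF]; exact mF) r (by rw [eF']; exact hr)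
    rwa [eF] at this
  · rw [← eH']
    exact red_splits (Hp (⟨tE, mt⟩ : B)) (Hp_monic _) (by rw [eH]; exact Hp_splits)
      (by rw [eH]; exact mH)
  · rw [← ht]; exact val_mem (φ := φ) ⟨tE, mt⟩

/-- Galois conjugates: residue `r` of a root of `Hp`, with Frobenius period dividing `n` -/
lemma order_of_place (p : ℕ) [Fact p.Prime] (t₀ : ℤ) (d : ℕ)
    (hr : ∀ (k : Type) [Field k] [CharP k p], (Hp (t₀ : k)).Splits →
      ∃ r : k, (Hp (t₀ : k)).eval r = 0 ∧ ∀ n, r ^ p ^ n = r → d ∣ n) :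
    ∃ g : h.Gal, d ∣ orderOf g := by
  obtain ⟨B, k, i1, i2, φ, σ, mH, lH, _, sp, _, fr⟩ := place p t₀
  obtain ⟨r, r0, rn⟩ := hr k sp
  obtain ⟨x, x0, xr⟩ := lH r r0
  refine ⟨Gal.restrict h E σ, ?_⟩
  apply rn
  have key : ∀ n : ℕ, ∀ y : B, (y : E) = (σ ^ n) x → φ y = r ^ p ^ n := by
    intro n
    induction n with
    | zero => 
      intro y hy
      have : y = x := Subtype.ext (by simpa using hy)
      rw [this, xr]; simp
    | succ n ih =>
      intro y hy
      have hz : (σ ^ n) (x : E) ∈ B := by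
        apply mH
        have e : (Hp tE) = (Hp t).map (algebraMap K E) := (Hp_map _ _).symm
        rw [e, eval_map_algebraMap] at x0 ⊢
        have := aeval_algHom_apply (σ ^ n : E ≃ₐ[K] E) (x : E) (Hp t)
        rw [this, x0, map_zero]
      have h1 := ih ⟨_, hz⟩ rfl
      have h2 := fr ⟨_, hz⟩ y (by rw [hy, pow_succ']; rfl)
      rw [h2, h1, ← pow_mul, pow_succ]
  have h1 := key (orderOf (Gal.restrict h E σ)) x ?_
  · rw [← h1, xr]
  · set n := orderOf (Gal.restrict h E σ)
    have hx0 : (h.map (algebraMap K E)).eval (15⁻¹ * (x : E)) = 0 := by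
      have := Hp_eval (15⁻¹ * (x : E))
      rw [mul_inv_cancel_left₀ (by norm_num), x0] at this
      have h15 : (15 ^ 11 : E) ≠ 0 := by norm_num
      exact (mul_eq_zero.1 this.symm).resolve_left h15
    have hm : 15⁻¹ * (x : E) ∈ h.rootSet E := by
      rw [mem_rootSet]
      refine ⟨h_ne, ?_⟩
      rw [← eval_map_algebraMap]; exact hx0
    have h2 := Gal.restrict_smul (σ ^ n) (⟨_, hm⟩ : h.rootSet E)
    rw [map_pow, pow_orderOf_eq_one, one_smul] at h2
    simp only [map_mul, map_inv₀, map_ofNat] at h2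
    exact mul_left_cancel₀ (by norm_num) h2
end FieldSec

section Ord
/-- value of a list of coefficients -/
def ev {k : Type} [Field k] (r : k) : List ℕ → k
  | [] => 0
  | a :: l => (a : k) + r * ev r l
def ladd (p : ℕ) : List ℕ → List ℕ → List ℕ
  | [], b => b
  | a :: l, [] => a :: l
  | a :: l, b :: m => (a + b) % p :: ladd p l m
def lsm (p c : ℕ) : List ℕ → List ℕ
  | [] => []
  | a :: l => (c * a) % p :: lsm p c l
def lred (p d : ℕ) (low c : List ℕ) : List ℕ :=
  match c.drop d with
  | [x] => ladd p (c.take d) (lsm p x low)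
  | _ => c
def lmul (p d : ℕ) (low : List ℕ) : List ℕ → List ℕ → List ℕ
  | [], _ => []
  | a :: l, b => ladd p (lsm p a b) (lred p d low (0 :: lmul p d low l b))
def lpow (p d : ℕ) (low c : List ℕ) : ℕ → List ℕ
  | 0 => [1]
  | n + 1 => lmul p d low c (lpow p d low c n)
def lfrob (p d : ℕ) (low : List ℕ) : ℕ → List ℕ
  | 0 => [0, 1]
  | n + 1 => lpow p d low (lfrob p d low n) p
def lchk (p d : ℕ) (low v : List ℕ) (e : ℕ) : Bool :=
  (ladd p (lfrob p d low d) [0, p - 1]).all (· == 0) &&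
  (ladd p (lmul p d low v (ladd p (lfrob p d low e) [0, p - 1])) [p - 1]).all (· == 0)

variable {k : Type} [Field k] (p : ℕ) [CharP k p] (r : k)

lemma cmod (n : ℕ) : ((n % p : ℕ) : k) = n := by
  rw [CharP.cast_eq_iff_mod_eq k p]; simp

lemma ev_ladd (a b : List ℕ) : ev r (ladd p a b) = ev r a + ev r b := by
  induction a generalizing b with
  | nil => simp [ladd, ev]
  | cons a l ih =>
    cases b with
    | nil => simp [ladd, ev]
    | cons b m => simp only [ladd, ev, ih, cmod]; push_cast; ring

lemma ev_lsm (c : ℕ) (a : List ℕ) : ev r (lsm p c a) = c * ev r a := by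
  induction a with
  | nil => simp [lsm, ev]
  | cons a l ih => simp only [lsm, ev, ih, cmod]; push_cast; ring

omit [CharP k p] in
lemma ev_split (d : ℕ) (c : List ℕ) : ev r c = ev r (c.take d) + r ^ d * ev r (c.drop d) := by
  induction d generalizing c with
  | zero => simp [ev]
  | succ d ih =>
    cases c with
    | nil => simp [ev]
    | cons a l => simp only [List.take_succ_cons, List.drop_succ_cons, ev]; rw [ih l]; ring

variable {d : ℕ} {low : List ℕ} (hl : r ^ d = ev r low)
include hl

lemma ev_lred (c : List ℕ) : ev r (lred p d low c) = ev r c := by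
  unfold lred
  split
  · rename_i x hx
    rw [ev_ladd, ev_lsm, ev_split r d c, hx, hl]
    simp [ev]; ring
  · rfl

lemma ev_lmul (a b : List ℕ) : ev r (lmul p d low a b) = ev r a * ev r b := by
  induction a with
  | nil => simp [lmul, ev]
  | cons a l ih =>
    rw [lmul, ev_ladd, ev_lsm, ev_lred p r hl, ev, ih, ev]; push_cast; ring

lemma ev_lpow (c : List ℕ) (n : ℕ) : ev r (lpow p d low c n) = ev r c ^ n := by
  induction n with
  | zero => simp [lpow, ev]
  | succ n ih => rw [lpow, ev_lmul p r hl, ih, pow_succ']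

lemma ev_lfrob (n : ℕ) : ev r (lfrob p d low n) = r ^ p ^ n := by
  induction n with
  | zero => simp [lfrob, ev]
  | succ n ih => rw [lfrob, ev_lpow p r hl, ih, ← pow_mul, pow_succ]

omit [CharP k p] hl in
lemma ev_zero (c : List ℕ) (hc : c.all (· == 0) = true) : ev r c = 0 := by
  induction c with
  | nil => rfl
  | cons a l ih =>
    rw [List.all_cons, Bool.and_eq_true, beq_iff_eq] at hc
    rw [ev, ih hc.2, hc.1]; simp

lemma per_of_chk [Fact p.Prime] (v : List ℕ) (q e : ℕ) [Fact q.Prime] (hd : d = q ^ (e + 1))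
    (hc : lchk p d low v (q ^ e) = true) (n : ℕ) (hn : r ^ p ^ n = r) : d ∣ n := by
  rw [lchk, Bool.and_eq_true] at hc
  have hp1 : ((p - 1 : ℕ) : k) = -1 := by
    rw [Nat.cast_sub (Fact.out : p.Prime).one_le, CharP.cast_eq_zero]; simp
  have h1 := ev_zero r _ hc.1
  have h2 := ev_zero r _ hc.2
  rw [ev_ladd, ev_lfrob p r hl] at h1
  rw [ev_ladd, ev_lmul p r hl, ev_ladd, ev_lfrob p r hl] at h2
  simp only [ev, hp1] at h1 h2
  have it : ∀ m, (fun x : k => x ^ p)^[m] r = r ^ p ^ m := by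
    intro m
    induction m with
    | zero => simp
    | succ m ih => rw [Function.iterate_succ_apply', ih, ← pow_mul, pow_succ]
  have h3 : ¬ Function.IsPeriodicPt (fun x : k => x ^ p) (q ^ e) r := by
    intro h4
    have h5 : (fun x : k => x ^ p)^[q ^ e] r = r := h4
    rw [it] at h5
    rw [h5] at h2
    simp at h2
  have h4 : Function.IsPeriodicPt (fun x : k => x ^ p) (q ^ (e + 1)) r := by
    change (fun x : k => x ^ p)^[q ^ (e + 1)] r = r
    rw [it, ← hd]
    have : r ^ p ^ d - r = 0 := by rw [← h1]; simp; ring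
    exact sub_eq_zero.1 this
  have h5 := Function.minimalPeriod_eq_prime_pow h3 h4
  rw [hd, ← h5]
  apply Function.IsPeriodicPt.minimalPeriod_dvd
  change (fun x : k => x ^ p)^[n] r = r
  rw [it, hn]
end Ord

section OrdCases

lemma ord_11 : ∃ g : h.Gal, 11 ∣ orderOf g := by
  have : Fact (Nat.Prime 7) := ⟨by norm_num⟩
  have : Fact (Nat.Prime 11) := ⟨by norm_num⟩
  apply order_of_place 7 5
  intro k _ _ hs
  have hp : ((7 : ℕ) : k[X]) = 0 := CharP.cast_eq_zero _ _
  have hf : Hp (((5 : ℤ)) : k) = ((6)*X^0 + (5)*X^1 + (3)*X^2 + (6)*X^3 + (5)*X^5 + (3)*X^7 + (1)*X^8 + (1)*X^11) * ((1)*X^0) := by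
    unfold Hp
    simp only [Int.cast_ofNat, Int.cast_one, map_ofNat, map_one]
    push_cast at hp
    linear_combination ((24713588169642)*X^0 + (-406808035715)*X^1 + (-754289899554)*X^2 + (7322544642)*X^3 + (1708593750)*X^4 + (122042410)*X^5 + (72321)*X^7 + (7232)*X^8) * hp
  have hd : ((6)*X^0 + (5)*X^1 + (3)*X^2 + (6)*X^3 + (5)*X^5 + (3)*X^7 + (1)*X^8 + (1)*X^11 : k[X]).natDegree = 11 := by compute_degree!
  have hsl : ((6)*X^0 + (5)*X^1 + (3)*X^2 + (6)*X^3 + (5)*X^5 + (3)*X^7 + (1)*X^8 + (1)*X^11 : k[X]).Splits := hs.of_dvd (Hp_monic _).ne_zero (by rw [hf]; exact dvd_mul_right _ _)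
  obtain ⟨r, hr⟩ := hsl.exists_eval_eq_zero (by rw [degree_eq_natDegree (by intro h0; rw [h0] at hd; simp at hd), hd]; norm_num)
  refine ⟨r, by rw [hf, eval_mul, hr, zero_mul], ?_⟩
  have hp' : ((7 : ℕ) : k) = 0 := CharP.cast_eq_zero _ _
  have hl : r ^ 11 = ev r [1, 2, 4, 1, 0, 2, 0, 4, 6, 0, 0] := by
    simp at hr
    simp [ev]
    push_cast at hp'
    linear_combination hr - (r^0 + r^1 + r^2 + r^3 + r^5 + r^7 + r^8) * hp'
  exact per_of_chk 7 r hl [5, 5, 1, 5, 4, 2, 2, 1, 5, 5, 3] 11 0 (by norm_num) (by decide +kernel)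

lemma ord_8 : ∃ g : h.Gal, 8 ∣ orderOf g := by
  have : Fact (Nat.Prime 7) := ⟨by norm_num⟩
  have : Fact (Nat.Prime 2) := ⟨by norm_num⟩
  apply order_of_place 7 2
  intro k _ _ hs
  have hp : ((7 : ℕ) : k[X]) = 0 := CharP.cast_eq_zero _ _
  have hf : Hp (((2 : ℤ)) : k) = ((4)*X^0 + (5)*X^1 + (3)*X^2 + (1)*X^3 + (4)*X^4 + (4)*X^5 + (4)*X^6 + (1)*X^7 + (1)*X^8) * ((2)*X^0 + (4)*X^1 + (6)*X^2 + (1)*X^3) := by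
    unfold Hp
    simp only [Int.cast_ofNat, Int.cast_one, map_ofNat, map_one]
    push_cast at hp
    linear_combination ((1581669642856)*X^0 + (-65089285718)*X^1 + (-54783482150)*X^2 + (1171607136)*X^3 + (273374995)*X^4 + (19526781)*X^5 + (-7)*X^6 + (28922)*X^7 + (2888)*X^8 + (-2)*X^9 + (-1)*X^10) * hp
  have hd : ((4)*X^0 + (5)*X^1 + (3)*X^2 + (1)*X^3 + (4)*X^4 + (4)*X^5 + (4)*X^6 + (1)*X^7 + (1)*X^8 : k[X]).natDegree = 8 := by compute_degree!
  have hsl : ((4)*X^0 + (5)*X^1 + (3)*X^2 + (1)*X^3 + (4)*X^4 + (4)*X^5 + (4)*X^6 + (1)*X^7 + (1)*X^8 : k[X]).Splits := hs.of_dvd (Hp_monic _).ne_zero (by rw [hf]; exact dvd_mul_right _ _)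
  obtain ⟨r, hr⟩ := hsl.exists_eval_eq_zero (by rw [degree_eq_natDegree (by intro h0; rw [h0] at hd; simp at hd), hd]; norm_num)
  refine ⟨r, by rw [hf, eval_mul, hr, zero_mul], ?_⟩
  have hp' : ((7 : ℕ) : k) = 0 := CharP.cast_eq_zero _ _
  have hl : r ^ 8 = ev r [3, 2, 4, 6, 3, 3, 3, 6] := by
    simp at hr
    simp [ev]
    push_cast at hp'
    linear_combination hr - (r^0 + r^1 + r^2 + r^3 + r^4 + r^5 + r^6 + r^7) * hp'
  exact per_of_chk 7 r hl [2, 5, 3, 4, 0, 2, 3, 2] 2 2 (by norm_num) (by decide +kernel)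

lemma ord_5 : ∃ g : h.Gal, 5 ∣ orderOf g := by
  have : Fact (Nat.Prime 11) := ⟨by norm_num⟩
  have : Fact (Nat.Prime 5) := ⟨by norm_num⟩
  apply order_of_place 11 3
  intro k _ _ hs
  have hp : ((11 : ℕ) : k[X]) = 0 := CharP.cast_eq_zero _ _
  have hf : Hp (((3 : ℤ)) : k) = ((9)*X^0 + (4)*X^1 + (2)*X^2 + (8)*X^3 + (10)*X^4 + (1)*X^5) * ((5)*X^0 + (6)*X^1 + (9)*X^3 + (4)*X^4 + (1)*X^5 + (1)*X^6) := by
    unfold Hp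
    simp only [Int.cast_ofNat, Int.cast_one, map_ofNat, map_one]
    push_cast at hp
    linear_combination ((3396995028405)*X^0 + (-93196022734)*X^1 + (-109893643469)*X^2 + (1677528397)*X^3 + (391423280)*X^4 + (27958797)*X^5 + (-9)*X^6 + (27602)*X^7 + (2756)*X^8 + (-2)*X^9 + (-1)*X^10) * hp
  have hd : ((9)*X^0 + (4)*X^1 + (2)*X^2 + (8)*X^3 + (10)*X^4 + (1)*X^5 : k[X]).natDegree = 5 := by compute_degree!
  have hsl : ((9)*X^0 + (4)*X^1 + (2)*X^2 + (8)*X^3 + (10)*X^4 + (1)*X^5 : k[X]).Splits := hs.of_dvd (Hp_monic _).ne_zero (by rw [hf]; exact dvd_mul_right _ _)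
  obtain ⟨r, hr⟩ := hsl.exists_eval_eq_zero (by rw [degree_eq_natDegree (by intro h0; rw [h0] at hd; simp at hd), hd]; norm_num)
  refine ⟨r, by rw [hf, eval_mul, hr, zero_mul], ?_⟩
  have hp' : ((11 : ℕ) : k) = 0 := CharP.cast_eq_zero _ _
  have hl : r ^ 5 = ev r [2, 7, 9, 3, 1] := by
    simp at hr
    simp [ev]
    push_cast at hp'
    linear_combination hr - (r^0 + r^1 + r^2 + r^3 + r^4) * hp'
  exact per_of_chk 11 r hl [5, 8, 9, 1, 8] 5 0 (by norm_num) (by decide +kernel)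

lemma ord_3 : ∃ g : h.Gal, 3 ∣ orderOf g := by
  have : Fact (Nat.Prime 11) := ⟨by norm_num⟩
  have : Fact (Nat.Prime 3) := ⟨by norm_num⟩
  apply order_of_place 11 1
  intro k _ _ hs
  have hp : ((11 : ℕ) : k[X]) = 0 := CharP.cast_eq_zero _ _
  have hf : Hp (((1 : ℤ)) : k) = ((4)*X^0 + (9)*X^2 + (1)*X^3) * ((5)*X^0 + (10)*X^1 + (8)*X^2 + (5)*X^3 + (5)*X^4 + (9)*X^5 + (4)*X^6 + (2)*X^7 + (1)*X^8) := by
    unfold Hp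
    simp only [Int.cast_ofNat, Int.cast_one, map_ofNat, map_one]
    push_cast at hp
    linear_combination ((125814630680)*X^0 + (-10355113640)*X^1 + (-5220703132)*X^2 + (186392035)*X^3 + (43491468)*X^4 + (3106526)*X^5 + (-6)*X^6 + (9196)*X^7 + (916)*X^8 + (-2)*X^9 + (-1)*X^10) * hp
  have hd : ((4)*X^0 + (9)*X^2 + (1)*X^3 : k[X]).natDegree = 3 := by compute_degree!
  have hsl : ((4)*X^0 + (9)*X^2 + (1)*X^3 : k[X]).Splits := hs.of_dvd (Hp_monic _).ne_zero (by rw [hf]; exact dvd_mul_right _ _)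
  obtain ⟨r, hr⟩ := hsl.exists_eval_eq_zero (by rw [degree_eq_natDegree (by intro h0; rw [h0] at hd; simp at hd), hd]; norm_num)
  refine ⟨r, by rw [hf, eval_mul, hr, zero_mul], ?_⟩
  have hp' : ((11 : ℕ) : k) = 0 := CharP.cast_eq_zero _ _
  have hl : r ^ 3 = ev r [7, 0, 2] := by
    simp at hr
    simp [ev]
    push_cast at hp'
    linear_combination hr - (r^0 + r^2) * hp'
  exact per_of_chk 11 r hl [5, 2, 3] 3 0 (by norm_num) (by decide +kernel)
end OrdCases

section Upper
def αs (i : ℕ) : ℤ := [15, 152, 217, 282, 288, 346, 369, 397, 408, 458, 477].getD i 0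
def βs (i : ℕ) : ℤ := [115, 369, 29, 136, 92, 369, 44, 66, 357, 115, 260].getD i 0
def ηs (i : ℕ) : ℤ := [22, 26, 81, 244, 259, 264, 323, 385, 394, 462, 465, 484].getD i 0
def HpE {R : Type*} [CommRing R] (t X : R) : R :=
  X^11 + 10125 * t * X^8 + 101250 * t * X^7 + 34171875 * t^2 * X^5 + 478406250 * t^2 * X^4
   + 2050312500 * t^2 * X^3 - 18984375000 * t^2 * X^2 - 113906250000 * t^2 * X
   - 38443359375 * t^3 * X^2 + 1383960937500 * t^3
def FpE {R : Type*} [CommRing R] (t X : R) : R :=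
  (X^2-80)^5*(X^2-20) + 40500 * t * (X^2-16)^3*((X+4)^3-1024)

lemma Hp_evalE {R : Type*} [CommRing R] (t x : R) : (Hp t).eval x = HpE t x := by
  simp [Hp, HpE]
lemma Fp_evalE {R : Type*} [CommRing R] (t x : R) : (Fp t).eval x = FpE t x := by
  simp [Fp, FpE]

lemma tab1 : ∀ i < 11, HpE 393 (15 * αs i) % 487 = 0 := by decide +kernel
lemma tab2 : ∀ i < 12, FpE 393 (4 * ηs i) % 487 = 0 := by decide +kernel
lemma tab3 : ∀ i < 11, αs i % 487 ≠ 0 ∧ DD (αs i) 393 % 487 ≠ 0 ∧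
  (βs i * DD (αs i) 393 - NN (αs i) 393) % 487 = 0 ∧ (βs i - αs i) % 487 ≠ 0 := by decide +kernel
lemma tab4 : ∀ i < 11, ∀ j < 11, i ≠ j → (αs i - αs j) % 487 ≠ 0 := by decide +kernel
lemma tab5 : ∀ i < 12, ∀ j < 12, i ≠ j → (ηs i - ηs j) % 487 ≠ 0 := by decide +kernel
lemma tab6 : ∀ i < 11, ∀ j < 12, ∀ k < 12,
    if mt i j = mt i k then
      (PP (αs i) (βs i) (ηs j) * QQ (αs i) (βs i) (ηs k) + PP (αs i) (βs i) (ηs k) * QQ (αs i) (βs i) (ηs j)) % 487 ≠ 0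
    else
      (PP (αs i) (βs i) (ηs j) * QQ (αs i) (βs i) (ηs k) - PP (αs i) (βs i) (ηs k) * QQ (αs i) (βs i) (ηs j)) % 487 ≠ 0 := by
  decide +kernel
end Upper

section Final
lemma Fp_natDegree {R : Type*} [CommRing R] [Nontrivial R] (t : R) : (Fp t).natDegree = 12 := by
  unfold Fp
  have d1 : ((X^2-80)^5*(X^2-20) : R[X]).natDegree = 12 := by
    rw [Monic.natDegree_mul, Monic.natDegree_pow]
    · have e1 : (X^2-80 : R[X]).natDegree = 2 := by compute_degree!
      have e2 : (X^2-20 : R[X]).natDegree = 2 := by compute_degree!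
      rw [e1, e2]
    · monicity!
    · apply Monic.pow; monicity!
    · monicity!
  have d2 : (40500 * C t * (X^2-16)^3*((X+4)^3-1024) : R[X]).natDegree ≤ 9 := by
    compute_degree
  rw [natDegree_add_eq_left_of_natDegree_lt (by omega), d1]

/-- if a polynomial of degree `n` has `n` distinct roots, these are all -/
lemma all_roots {L : Type} [Field L] (F : L[X]) (hF : F ≠ 0) (n : ℕ) (hd : F.natDegree = n) (a : Fin n → L)
    (ha : Function.Injective a) (h0 : ∀ i, F.eval (a i) = 0) (x : L) (hx : F.eval x = 0) :
    ∃ i, a i = x := by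
  classical
  have h1 : Finset.univ.image a ⊆ F.roots.toFinset := by
    intro z hz
    obtain ⟨i, _, rfl⟩ := Finset.mem_image.1 hz
    rw [Multiset.mem_toFinset, mem_roots hF]; exact h0 i
  have h2 : F.roots.toFinset.card ≤ n := (Multiset.toFinset_card_le _).trans (hd ▸ card_roots' F)
  have h3 : (Finset.univ.image a).card = n := by rw [Finset.card_image_of_injective _ ha]; simp
  have h4 := Finset.eq_of_subset_of_card_le h1 (by omega)
  have h5 : x ∈ Finset.univ.image a := by
    rw [h4, Multiset.mem_toFinset, mem_roots hF]; exact hx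
  obtain ⟨i, _, hi⟩ := Finset.mem_image.1 h5
  exact ⟨i, hi⟩

noncomputable def bb (a : E) : E := NN a tE / DD a tE
noncomputable def WW (a y z : E) : E :=
  PP a (bb a) y * QQ a (bb a) z - PP a (bb a) z * QQ a (bb a) y

lemma map_PP {R S : Type*} [CommRing R] [CommRing S] (f : R →+* S) (a b y : R) :
    f (PP a b y) = PP (f a) (f b) (f y) := by
  have e : ∀ n : ℕ, ∀ [n.AtLeastTwo], f (OfNat.ofNat n) = OfNat.ofNat n := fun n _ => map_ofNat f n
  simp [PP, e]
lemma map_QQ {R S : Type*} [CommRing R] [CommRing S] (f : R →+* S) (a b y : R) :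
    f (QQ a b y) = QQ (f a) (f b) (f y) := by
  have e : ∀ n : ℕ, ∀ [n.AtLeastTwo], f (OfNat.ofNat n) = OfNat.ofNat n := fun n _ => map_ofNat f n
  simp [QQ, e]
lemma map_NN {R S : Type*} [CommRing R] [CommRing S] (f : R →+* S) (a b : R) :
    f (NN a b) = NN (f a) (f b) := by
  have e : ∀ n : ℕ, ∀ [n.AtLeastTwo], f (OfNat.ofNat n) = OfNat.ofNat n := fun n _ => map_ofNat f n
  simp [NN, e]
lemma map_DD {R S : Type*} [CommRing R] [CommRing S] (f : R →+* S) (a b : R) :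
    f (DD a b) = DD (f a) (f b) := by
  have e : ∀ n : ℕ, ∀ [n.AtLeastTwo], f (OfNat.ofNat n) = OfNat.ofNat n := fun n _ => map_ofNat f n
  simp [DD, e]
lemma map_HpE {R S : Type*} [CommRing R] [CommRing S] (f : R →+* S) (a b : R) :
    f (HpE a b) = HpE (f a) (f b) := by
  have e : ∀ n : ℕ, ∀ [n.AtLeastTwo], f (OfNat.ofNat n) = OfNat.ofNat n := fun n _ => map_ofNat f n
  simp [HpE, e]
lemma map_FpE {R S : Type*} [CommRing R] [CommRing S] (f : R →+* S) (a b : R) :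
    f (FpE a b) = FpE (f a) (f b) := by
  have e : ∀ n : ℕ, ∀ [n.AtLeastTwo], f (OfNat.ofNat n) = OfNat.ofNat n := fun n _ => map_ofNat f n
  simp [FpE, e]

lemma map_WW (σ : E ≃ₐ[K] E) (a y z : E) : σ (WW a y z) = WW (σ a) (σ y) (σ z) := by
  have ht : σ tE = tE := σ.commutes t
  have hb : σ (bb a) = bb (σ a) := by
    unfold bb
    rw [map_div₀]
    have h1 := map_NN (σ : E →+* E) a tE
    have h2 := map_DD (σ : E →+* E) a tE
    simp only [RingHom.coe_coe] at h1 h2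
    rw [h1, h2, ht]
  have h1 := fun y => map_PP (σ : E →+* E) a (bb a) y
  have h2 := fun y => map_QQ (σ : E →+* E) a (bb a) y
  simp only [RingHom.coe_coe] at h1 h2
  unfold WW
  rw [map_sub, map_mul, map_mul, h1, h1, h2, h2, hb]

lemma root_expand (a : E) (h0 : (h.map (algebraMap K E)).eval a = 0) :
    1*a^11 + 3*a^8*tE + 2*a^7*tE + 3*a^5*tE^2 + (14/5)*a^4*tE^2 + (4/5)*a^3*tE^2 + (-1)*a^2*tE^3 + (-40/81)*a^2*tE^2 + (-16/81)*a*tE^2 + (4/25)*tE^3 = 0 := by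
  rw [← h0, map_h]
  simp
  ring

lemma sq_rel (a y z : E) (h0 : (h.map (algebraMap K E)).eval a = 0) (ha : a ≠ 0)
    (hD : DD a tE ≠ 0) (hba : bb a - a ≠ 0) (hy : f12 y tE = 0) (hz : f12 z tE = 0) :
    PP a (bb a) y * QQ a (bb a) z = PP a (bb a) z * QQ a (bb a) y ∨
    PP a (bb a) y * QQ a (bb a) z = -(PP a (bb a) z * QQ a (bb a) y) := by
  obtain ⟨hc, hX⟩ := cubic_rel a tE (bb a) (root_expand a h0) hD rfl
  have h1 := PQ_rel a tE (bb a) y hc hX ha hy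
  have h2 := PQ_rel a tE (bb a) z hc hX ha hz
  apply sq_eq_sq_iff_eq_or_eq_neg.1
  have h45 : (45 * (bb a - a) : E) ≠ 0 := mul_ne_zero (by norm_num) hba
  apply mul_left_cancel₀ h45
  linear_combination QQ a (bb a) z ^ 2 * h1 - QQ a (bb a) y ^ 2 * h2

lemma data : ∃ (a : Fin 11 → E) (y : Fin 12 → E), Function.Injective a ∧ Function.Injective y ∧
    (∀ i, (h.map (algebraMap K E)).eval (a i) = 0) ∧ (∀ j, (Fp tE).eval (4 * y j) = 0) ∧
    ∀ i j k, WW (a i) (y j) (y k) = 0 ↔ mt i j = mt i k := by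
  have : Fact (Nat.Prime 487) := ⟨by norm_num⟩
  obtain ⟨B, k, i1, i2, φ, σ, mH, lH, lF, sp, vt, fr⟩ := place 487 393
  have z0 : ∀ n : ℤ, n % 487 = 0 → (n : k) = 0 := by
    intro n hn
    rw [CharP.intCast_eq_zero_iff k 487]
    exact Int.dvd_of_emod_eq_zero hn
  have z1 : ∀ n : ℤ, n % 487 ≠ 0 → (n : k) ≠ 0 := by
    intro n hn h0
    rw [CharP.intCast_eq_zero_iff k 487] at h0
    exact hn (Int.emod_eq_zero_of_dvd h0)
  have h15 : (15 : k) ≠ 0 := by have := z1 15 (by norm_num); simpa using this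
  have h4 : (4 : k) ≠ 0 := by have := z1 4 (by norm_num); simpa using this
  have ex : ∀ i : Fin 11, ∃ a : E, (h.map (algebraMap K E)).eval a = 0 ∧ Val φ a (αs i : k) := by
    intro i
    obtain ⟨x, x0, xr⟩ := lH (15 * (αs i : k)) (by
      rw [Hp_evalE]
      have h1 := z0 _ (tab1 i i.2)
      have h2 := map_HpE (Int.castRingHom k) 393 (15 * αs i)
      rw [eq_intCast, h1] at h2
      rw [h2]; simp)
    refine ⟨x / 15, ?_, ?_⟩
    · have := Hp_eval ((x : E) / 15)
      rw [mul_div_cancel₀ _ (by norm_num), x0] at this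
      have h15 : (15 ^ 11 : E) ≠ 0 := by norm_num
      exact (mul_eq_zero.1 this.symm).resolve_left h15
    · have := val_div (val_mem (φ := φ) x) (val_num 15) h15
      rwa [xr, mul_div_cancel_left₀ _ h15] at this
  have ey : ∀ i : Fin 12, ∃ a : E, (Fp tE).eval (4 * a) = 0 ∧ Val φ a (ηs i : k) := by
    intro i
    obtain ⟨x, x0, xr⟩ := lF (4 * (ηs i : k)) (by
      rw [Fp_evalE]
      have h1 := z0 _ (tab2 i i.2)
      have h2 := map_FpE (Int.castRingHom k) 393 (4 * ηs i)
      rw [eq_intCast, h1] at h2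
      rw [h2]; simp)
    refine ⟨x / 4, ?_, ?_⟩
    · rw [mul_div_cancel₀ _ (by norm_num), x0]
    · have := val_div (val_mem (φ := φ) x) (val_num 4) h4
      rwa [xr, mul_div_cancel_left₀ _ h4] at this
  choose a a0 aV using ex
  choose y y0 yV using ey
  have f0 : ∀ j, f12 (y j) tE = 0 := by
    intro j
    have h1 := y0 j
    rw [Fp_evalE] at h1
    have h2 : FpE tE (4 * y j) = 16 ^ 5 * f12 (y j) tE := by
      unfold FpE f12; ring
    rw [h2] at h1
    exact (mul_eq_zero.1 h1).resolve_left (by norm_num)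
  refine ⟨a, y, ?_, ?_, a0, y0, ?_⟩
  · intro i j hij
    by_contra hne
    have h1 := z1 _ (tab4 i i.2 j j.2 (fun h => hne (Fin.ext h)))
    push_cast at h1
    exact val_ne (val_sub (aV i) (aV j)) h1 (sub_eq_zero.2 hij)
  · intro i j hij
    by_contra hne
    have h1 := z1 _ (tab5 i i.2 j j.2 (fun h => hne (Fin.ext h)))
    push_cast at h1
    exact val_ne (val_sub (yV i) (yV j)) h1 (sub_eq_zero.2 hij)
  · intro i j l
    obtain ⟨t1, t2, t3, t4⟩ := tab3 i i.2
    have d1 := z1 _ t2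
    have e1 := map_DD (Int.castRingHom k) (αs i) 393
    rw [eq_intCast, eq_intCast, eq_intCast] at e1
    have e2 := map_NN (Int.castRingHom k) (αs i) 393
    rw [eq_intCast, eq_intCast, eq_intCast] at e2
    have vD := val_DD (aV i) vt
    have vN := val_NN (aV i) vt
    rw [← e1] at vD
    rw [← e2] at vN
    have vb : Val φ (bb (a i)) (βs i : k) := by
      have h1 := val_div vN vD d1
      have h2 := z0 _ t3
      push_cast at h2
      rwa [← sub_eq_zero.1 h2, mul_div_cancel_right₀ _ d1] at h1
    have n1 := val_ne (aV i) (z1 _ t1)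
    have n2 := val_ne vD d1
    have n3 := val_ne (val_sub vb (aV i)) (by have := z1 _ t4; push_cast at this; exact this)
    have key := sq_rel (a i) (y j) (y l) (a0 i) n1 n2 n3 (f0 j) (f0 l)
    have vP := fun j => val_PP (aV i) vb (yV j)
    have vQ := fun j => val_QQ (aV i) vb (yV j)
    have cP : ∀ j : Fin 12, PP (αs i : k) (βs i) (ηs j) = ((PP (αs i) (βs i) (ηs j) : ℤ) : k) :=
      fun j => (map_PP (Int.castRingHom k) _ _ _).symm
    have cQ : ∀ j : Fin 12, QQ (αs i : k) (βs i) (ηs j) = ((QQ (αs i) (βs i) (ηs j) : ℤ) : k) :=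
      fun j => (map_QQ (Int.castRingHom k) _ _ _).symm
    simp only [cP] at vP
    simp only [cQ] at vQ
    have t6 := tab6 i i.2 j j.2 l l.2
    have vA := val_mul (vP j) (vQ l)
    have vB := val_mul (vP l) (vQ j)
    split_ifs at t6 with hm
    · refine ⟨fun _ => hm, fun _ => ?_⟩
      have h1 := z1 _ t6
      push_cast at h1
      have h2 := val_ne (val_add vA vB) h1
      rcases key with key | key
      · unfold WW; rw [key, sub_self]
      · exact absurd (by rw [key]; ring) h2
    · refine ⟨fun h0 => ?_, fun h => absurd h hm⟩
      have h1 := z1 _ t6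
      push_cast at h1
      exact absurd h0 (val_ne (val_sub vA vB) h1)

instance instFaithful : FaithfulSMul h.Gal (h.rootSet E) where
  eq_of_smul_eq_smul := by
    intro g g' hg
    apply Gal.galActionHom_injective h E
    ext x
    exact congrArg Subtype.val (hg x)

lemma card_data : Nat.card (h.rootSet E) = 11 ∧ Nat.card h.Gal ≤ 7920 := by
  obtain ⟨a, y, ai, yi, a0, y0, hW⟩ := data
  have hm0 : h.map (algebraMap K E) ≠ 0 := Polynomial.map_ne_zero h_ne
  have alla := all_roots (h.map (algebraMap K E)) hm0 11 (by rw [natDegree_map, h_natDegree]) a ai a0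
  have ally := all_roots (Fp tE) (Fp_monic _).ne_zero 12 (Fp_natDegree _) (fun j => 4 * y j)
    (fun i j hij => yi (mul_left_cancel₀ (by norm_num) hij)) y0
  have mem : ∀ i, a i ∈ h.rootSet E := by
    intro i
    rw [mem_rootSet]
    exact ⟨h_ne, by rw [← eval_map_algebraMap]; exact a0 i⟩
  let A : Fin 11 → h.rootSet E := fun i => ⟨a i, mem i⟩
  have hA : Function.Bijective A := by
    refine ⟨fun i j hij => ai (congrArg Subtype.val hij), ?_⟩
    rintro ⟨x, hx⟩
    have hx' := (mem_rootSet.1 hx).2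
    rw [← eval_map_algebraMap] at hx'
    obtain ⟨i, hi⟩ := alla x hx'
    exact ⟨i, Subtype.ext hi⟩
  have hcard : Nat.card (h.rootSet E) = 11 := by
    rw [← Nat.card_eq_of_bijective A hA]; simp
  refine ⟨hcard, ?_⟩
  have fix : ∀ g : h.Gal, (∀ i : Fin 11, i.1 < 4 → g • A i = A i) → g = 1 := by
    intro g hg
    obtain ⟨σ, rfl⟩ := Gal.restrict_surjective h E g
    have hσ : ∀ x : h.rootSet E, ((Gal.restrict h E σ • x : h.rootSet E) : E) = σ x :=
      fun x => Gal.restrict_smul σ x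
    have ea : ∀ i, ∃ j, a j = σ (a i) := by
      intro i
      obtain ⟨j, hj⟩ := hA.2 (Gal.restrict h E σ • A i)
      exact ⟨j, by rw [← hσ (A i), ← hj]⟩
    have ey : ∀ i, ∃ j, y j = σ (y i) := by
      intro i
      have e : (Fp tE) = (Fp t).map (algebraMap K E) := (Fp_map _ _).symm
      have h1 : (Fp tE).eval (σ (4 * y i)) = 0 := by
        have x0 := y0 i
        rw [e, eval_map_algebraMap] at x0 ⊢
        have := aeval_algHom_apply σ (4 * y i : E) (Fp t)
        rw [this, x0, map_zero]
      obtain ⟨j, hj⟩ := ally _ h1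
      refine ⟨j, ?_⟩
      simp only [map_mul, map_ofNat] at hj
      exact mul_left_cancel₀ (by norm_num) hj
    choose π hπ using ea
    choose τ hτ using ey
    have hτi : Function.Injective τ := by
      intro i j hij
      apply yi
      apply σ.injective
      rw [← hτ, ← hτ, hij]
    have hf : ∀ i : Fin 11, i.1 < 4 → π i = i := by
      intro i hi
      apply ai
      rw [hπ, ← hσ (A i), hg i hi]
    have hid := comb π τ hτi (by
      intro i j l
      rw [← hW, ← hW, hπ, hτ, hτ, ← map_WW]
      exact (map_eq_zero_iff σ σ.injective).symm) (hf 0 (by decide)) (hf 1 (by decide)) (hf 2 (by decide)) (hf 3 (by decide))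
    apply FaithfulSMul.eq_of_smul_eq_smul (α := h.rootSet E)
    intro x
    obtain ⟨i, rfl⟩ := hA.2 x
    apply Subtype.ext
    rw [hσ, one_smul]
    change σ (a i) = a i
    rw [← hπ, hid]
  let Φ : h.Gal → (Fin 4 ↪ h.rootSet E) := fun g =>
    ⟨fun i => g • A (Fin.castLE (by norm_num) i), fun i j hij => by
      have := hA.1 (MulAction.injective g hij)
      exact Fin.castLE_injective _ this⟩
  have hΦ : Function.Injective Φ := by
    intro g g' hgg
    have h1 : g'⁻¹ * g = 1 := by
      apply fix
      intro i hi
      have h2 := congrArg (fun f => f ⟨i.1, hi⟩) hgg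
      have h3 : g • A i = g' • A i := h2
      rw [mul_smul, h3, inv_smul_smul]
    exact (inv_mul_eq_one.1 h1).symm
  classical
  have : Fintype (h.rootSet E) := Fintype.ofBijective A hA
  calc Nat.card h.Gal ≤ Nat.card (Fin 4 ↪ h.rootSet E) := Nat.card_le_card_of_injective Φ hΦ
    _ = 7920 := by
      rw [Nat.card_eq_fintype_card, Fintype.card_embedding_eq, ← Nat.card_eq_fintype_card, hcard]
      simp [Nat.descFactorial]

lemma dvd_aux (N : ℕ) (h1 : 11 ∣ N) (h2 : 8 ∣ N) (h3 : 5 ∣ N) (h4 : 3 ∣ N) : 1320 ∣ N := by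
  have a1 : 88 ∣ N := Nat.Coprime.mul_dvd_of_dvd_of_dvd (by norm_num) h1 h2
  have a2 : 15 ∣ N := Nat.Coprime.mul_dvd_of_dvd_of_dvd (by norm_num) h3 h4
  exact Nat.Coprime.mul_dvd_of_dvd_of_dvd (m := 88) (n := 15) (by norm_num) a1 a2

lemma dvd_of_ord {G : Type} [Group G] (d : ℕ) (hd : ∃ g : G, d ∣ orderOf g) : d ∣ Nat.card G := by
  obtain ⟨g, hg⟩ := hd
  exact hg.trans (orderOf_dvd_natCard g)

lemma dvd_card : 1320 ∣ Nat.card h.Gal :=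
  dvd_aux _ (dvd_of_ord _ ord_11) (dvd_of_ord _ ord_8) (dvd_of_ord _ ord_5) (dvd_of_ord _ ord_3)
end Final
end M11

theorem m11_deg11_h : h.natDegree = 11 ∧ IsSimpleGroup h.Gal ∧ Nat.card h.Gal = 7920 := by
  obtain ⟨g, hg⟩ := M11.ord_8
  obtain ⟨hc, hle⟩ := M11.card_data
  exact ⟨M11.h_natDegree, M11.simple_of hc M11.dvd_card hle g hg,
    (M11.card_7920 hc M11.dvd_card hle g hg).1⟩
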